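/- Let d ≥ 1, T > 0, and let Ω ⊂ ℝ^d be a bounded open set with smooth boundary and outward unit normal n. Let ρ ∈ L²((0,T) × Ω) and ρ_in ∈ L²(Ω) satisfy, for every ψ ∈ C^∞([0,T] × cl(Ω)) with ψ(T,·) = 0 and ∇_x ψ(t,x)·n(x) = 0 on (0,T) × ∂Ω, the identity ∫₀^T ∫_Ω ρ (∂_t ψ + Δ_x ψ) dx dt + ∫_Ω ρ_in ψ(0,·) dx = 0. Then ρ has square-integrable distributional spatial gradient: for each i ∈ {1,…,d} there exists g_i ∈ L²((0,T) × Ω) such that ∫₀^T ∫_Ω ρ ∂u/∂x_i dx dt = − ∫₀^T ∫_Ω g_i u dx dt for every smooth compactly supported u : (0,T) × Ω → ℝ; moreover there is a constant C depending only on ‖ρ_in‖_{L²(Ω)} and ‖ρ‖_{L²((0,T)×Ω)} with ‖g_i‖_{L²((0,T)×Ω)} ≤ C (i.e. ρ ∈ L²(0,T; H¹(Ω))). -/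

import Mathlib

open MeasureTheory Real Set Filter Topology Bornology
open scoped ENNReal RealInnerProductSpace

noncomputable section

abbrev Eu (d : ℕ) := EuclideanSpace ℝ (Fin d)

/-- Standard basis vector of `ℝ^d`. -/
def basisE (d : ℕ) (i : Fin d) : Eu d := EuclideanSpace.single i 1

/-- Laplacian of a scalar function on `ℝ^d`. -/
def lapE {d : ℕ} (f : Eu d → ℝ) (x : Eu d) : ℝ :=
  ∑ i, fderiv ℝ (fun y => fderiv ℝ f y (basisE d i)) x (basisE d i)

/-- The outward unit normal associated to the defining function `ζ`. -/
def unitNormal {d : ℕ} (ζ : Eu d → ℝ) (x : Eu d) : Eu d :=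
  ‖gradient ζ x‖⁻¹ • gradient ζ x

/-- If `v` has weak derivative `q` on `(0, T)` and initial value `c`, then
`∫ v q = (v(T)² - c²) / 2 ≥ -c² / 2`. -/
theorem neg_half_sq_le_integral_mul_of_weak_deriv {T : ℝ} (hT : 0 < T) {v q : ℝ → ℝ} {c : ℝ}
    (hv : IntegrableOn v (Ioo 0 T)) (hq : IntegrableOn q (Ioo 0 T))
    (h : ∀ θ : ℝ → ℝ, ContDiff ℝ (⊤ : ℕ∞) θ → θ T = 0 →
      (∫ t in Ioo 0 T, (deriv θ t * v t + θ t * q t)) + θ 0 * c = 0) :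
    -(c ^ 2) / 2 ≤ ∫ t in Ioo 0 T, v t * q t := by
  have hioo : ∀ f : ℝ → ℝ, ∫ t in Ioo 0 T, f t = ∫ t in (0 : ℝ)..T, f t := fun f => by
    rw [intervalIntegral.integral_of_le hT.le, integral_Ioc_eq_integral_Ioo]
  have hqi : IntervalIntegrable q volume 0 T := by
    rw [intervalIntegrable_iff_integrableOn_Ioo_of_le hT.le]; exact hq
  have h0 : (0 : ℝ) ∈ uIcc 0 T := by simp
  set Q : ℝ → ℝ := fun t => c + ∫ s in (0 : ℝ)..t, q s with hQ
  have hconst : AbsolutelyContinuousOnInterval (fun _ : ℝ => c) 0 T :=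
    ContDiffOn.absolutelyContinuousOnInterval contDiff_const.contDiffOn
  have hQac : AbsolutelyContinuousOnInterval Q 0 T :=
    hconst.add (hqi.absolutelyContinuousOnInterval_intervalIntegral h0)
  have hQ0 : Q 0 = c := by simp [hQ]
  have hQd : ∀ᵐ t, t ∈ uIcc 0 T → deriv Q t = q t := by
    filter_upwards [hqi.ae_hasDerivAt_integral] with t ht hmem
    exact ((ht hmem 0 h0).const_add c).deriv
  have hQcont : ContinuousOn Q (uIcc 0 T) := hQac.continuousOn
  have hQint : IntegrableOn Q (Ioo 0 T) := by
    rw [← intervalIntegrable_iff_integrableOn_Ioo_of_le hT.le]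
    exact hQcont.intervalIntegrable
  have hibp : ∀ θ : ℝ → ℝ, ContDiff ℝ (⊤ : ℕ∞) θ →
      ∫ t in (0 : ℝ)..T, Q t * deriv θ t = Q T * θ T - c * θ 0 - ∫ t in (0 : ℝ)..T, q t * θ t := by
    intro θ hθ
    have hθac : AbsolutelyContinuousOnInterval θ 0 T :=
      ContDiffOn.absolutelyContinuousOnInterval ((hθ.of_le (by simp)).contDiffOn)
    rw [hQac.integral_mul_deriv_eq_deriv_mul hθac, hQ0]
    congr 1
    apply intervalIntegral.integral_congr_ae
    filter_upwards [hQd] with t ht hmem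
    rw [ht (uIoc_subset_uIcc hmem)]
  have hae : ∀ᵐ t, t ∈ Ioo 0 T → v t - Q t = 0 := by
    refine IsOpen.ae_eq_zero_of_integral_contDiff_smul_eq_zero isOpen_Ioo
      (hv.sub hQint).locallyIntegrableOn ?_
    intro f hf hfc hfs
    set θ : ℝ → ℝ := fun t => ∫ s in T..t, f s with hθdef
    have hθd : ∀ t, HasDerivAt θ (f t) t := fun t =>
      intervalIntegral.integral_hasDerivAt_right (hf.continuous.intervalIntegrable _ _)
        (hf.continuous.stronglyMeasurableAtFilter _ _) hf.continuous.continuousAt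
    have hθd' : deriv θ = f := funext fun t => (hθd t).deriv
    have hθ : ContDiff ℝ (⊤ : ℕ∞) θ := by
      rw [contDiff_infty_iff_deriv, hθd']
      exact ⟨fun t => (hθd t).differentiableAt, hf⟩
    have hθT : θ T = 0 := by simp [hθdef]
    have e1 := h θ hθ hθT
    have e2 := hibp θ hθ
    rw [hθd', hθT] at e2
    rw [hθd', hioo] at e1
    have iv : IntervalIntegrable v volume 0 T := by
      rw [intervalIntegrable_iff_integrableOn_Ioo_of_le hT.le]; exact hv
    have i1 : IntervalIntegrable (fun t => f t * v t) volume 0 T :=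
      iv.continuousOn_mul hf.continuous.continuousOn
    have i2 : IntervalIntegrable (fun t => θ t * q t) volume 0 T :=
      hqi.continuousOn_mul hθ.continuous.continuousOn
    have i3 : IntervalIntegrable (fun t => f t * Q t) volume 0 T :=
      (hf.continuous.continuousOn.mul hQcont).intervalIntegrable
    rw [intervalIntegral.integral_add i1 i2] at e1
    have e3 : ∫ t in (0 : ℝ)..T, q t * θ t = ∫ t in (0 : ℝ)..T, θ t * q t := by
      simp_rw [mul_comm]
    have e4 : ∫ t in (0 : ℝ)..T, Q t * f t = ∫ t in (0 : ℝ)..T, f t * Q t := by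
      simp_rw [mul_comm]
    have e5 : ∫ t, f t • (v t - Q t) = ∫ t in Ioo 0 T, f t • (v t - Q t) := by
      symm
      apply setIntegral_eq_integral_of_forall_compl_eq_zero
      intro t ht
      have : f t = 0 := by
        by_contra hne
        exact ht (hfs (subset_tsupport f hne))
      simp [this]
    change ∫ t, f t • (v t - Q t) = 0
    rw [e5, hioo]
    simp_rw [smul_eq_mul, mul_sub]
    rw [intervalIntegral.integral_sub i1 i3]
    linarith
  have e6 : ∫ t in Ioo 0 T, v t * q t = ∫ t in (0 : ℝ)..T, Q t * deriv Q t := by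
    rw [← hioo]
    apply setIntegral_congr_ae measurableSet_Ioo
    filter_upwards [hae, hQd] with t h1 h2 hm
    rw [h2 (by rw [uIcc_of_le hT.le]; exact Ioo_subset_Icc_self hm), sub_eq_zero.1 (h1 hm)]
  have e7 := hQac.integral_mul_deriv_eq_deriv_mul hQac
  have e8 : ∫ t in (0 : ℝ)..T, deriv Q t * Q t = ∫ t in (0 : ℝ)..T, Q t * deriv Q t := by
    simp_rw [mul_comm]
  rw [e6]
  rw [e8, hQ0] at e7
  nlinarith [sq_nonneg (Q T)]

/-- Cauchy–Schwarz inequality for real integrals. -/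
theorem sq_integral_mul_le {α : Type*} [MeasurableSpace α] {μ : Measure α} {f g : α → ℝ}
    (hf : Integrable (fun x => f x ^ 2) μ) (hg : Integrable (fun x => g x ^ 2) μ)
    (hfg : Integrable (fun x => f x * g x) μ) :
    (∫ x, f x * g x ∂μ) ^ 2 ≤ (∫ x, f x ^ 2 ∂μ) * ∫ x, g x ^ 2 ∂μ := by
  have key : ∀ s : ℝ, 0 ≤ (∫ x, g x ^ 2 ∂μ) * (s * s) + (2 * ∫ x, f x * g x ∂μ) * s
      + ∫ x, f x ^ 2 ∂μ := by
    intro s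
    have h1 : ∫ x, (f x + s * g x) ^ 2 ∂μ
        = (∫ x, g x ^ 2 ∂μ) * (s * s) + (2 * ∫ x, f x * g x ∂μ) * s + ∫ x, f x ^ 2 ∂μ := by
      have : ∀ x, (f x + s * g x) ^ 2 = (s * s) * g x ^ 2 + (2 * s) * (f x * g x) + f x ^ 2 :=
        fun x => by ring
      simp_rw [this]
      have i1 : Integrable (fun x => (s * s) * g x ^ 2 + (2 * s) * (f x * g x)) μ :=
        (hg.const_mul _).add (hfg.const_mul _)
      rw [integral_add i1 hf,
        integral_add (hg.const_mul _) (hfg.const_mul _), integral_const_mul, integral_const_mul]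
      ring
    rw [← h1]
    exact integral_nonneg fun x => sq_nonneg _
  have := discrim_le_zero key
  rw [discrim] at this
  nlinarith

/-- Riesz representation for a functional on a vector space that is bounded with respect to the
seminorm pulled back from a Hilbert space. -/
theorem exists_inner_eq_of_bounded {E H : Type*} [AddCommGroup E] [Module ℝ E]
    [NormedAddCommGroup H] [InnerProductSpace ℝ H] [CompleteSpace H]
    (ι : E →ₗ[ℝ] H) (l : E →ₗ[ℝ] ℝ) {K : ℝ} (hK : 0 ≤ K) (hl : ∀ u, |l u| ≤ K * ‖ι u‖) :
    ∃ g : H, ‖g‖ ≤ K ∧ ∀ u, l u = ⟪g, ι u⟫ := by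
  obtain ⟨s, hs⟩ := ι.rangeRestrict.exists_rightInverse_of_surjective ι.range_rangeRestrict
  have hs' : ∀ y, ι (s y) = y := fun y => by
    have := LinearMap.congr_fun hs y
    exact congrArg Subtype.val this
  have hz : ∀ u u', ι u = ι u' → l u = l u' := by
    intro u u' h
    have := hl (u - u')
    rw [map_sub, map_sub, h, sub_self, norm_zero, mul_zero] at this
    exact sub_eq_zero.1 (abs_nonpos_iff.1 this)
  let φ : StrongDual ℝ (LinearMap.range ι) := (l.comp s).mkContinuous K fun y => by
    simpa [hs'] using hl (s y)
  obtain ⟨Φ, hΦ, hn⟩ := exists_extension_norm_eq (LinearMap.range ι) φ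
  refine ⟨(InnerProductSpace.toDual ℝ H).symm Φ, ?_, fun u => ?_⟩
  · rw [LinearIsometryEquiv.norm_map, hn]
    exact LinearMap.mkContinuous_norm_le _ hK _
  · rw [InnerProductSpace.toDual_symm_apply]
    have := hΦ ⟨ι u, LinearMap.mem_range_self ι u⟩
    simp only at this
    rw [this]
    exact hz _ _ (hs' ⟨ι u, LinearMap.mem_range_self ι u⟩).symm

/-- The `i`-th partial derivative of a scalar function on `ℝ^d`. -/
def partialE {d : ℕ} (i : Fin d) (f : Eu d → ℝ) (x : Eu d) : ℝ := fderiv ℝ f x (basisE d i)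

theorem lapE_eq_sum {d : ℕ} (f : Eu d → ℝ) (x : Eu d) :
    lapE f x = ∑ i, partialE i (partialE i f) x := rfl

/-- A jointly smooth kernel whose sections over `Ω` are supported in a fixed ball. -/
structure RegKernel {d : ℕ} (Ω : Set (Eu d)) (r : ℝ) (K : Eu d → Eu d → ℝ) : Prop where
  smooth : ContDiff ℝ (⊤ : ℕ∞) (fun p : Eu d × Eu d => K p.1 p.2)
  supp : ∀ x ∈ Ω, ∀ z, r < ‖z‖ → K x z = 0

/-- The image of `w` under the integral operator with kernel `K` over `Ω`. -/
def kint {d : ℕ} (Ω : Set (Eu d)) (w : Eu d → ℝ) (K : Eu d → Eu d → ℝ) (z : Eu d) : ℝ :=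
  ∫ x in Ω, w x * K x z

theorem integrableOn_of_sq {d : ℕ} {Ω : Set (Eu d)} (hb : IsBounded Ω) {w : Eu d → ℝ}
    (hw : Measurable w) (hw2 : IntegrableOn (fun x => w x ^ 2) Ω) : IntegrableOn w Ω := by
  have : IsFiniteMeasure (volume.restrict Ω) :=
    isFiniteMeasure_restrict.2 hb.measure_lt_top.ne
  exact ((memLp_two_iff_integrable_sq hw.aestronglyMeasurable).2 hw2).integrable (by norm_num)

theorem exists_bound_of_continuous {d : ℕ} {G : Type*} [NormedAddCommGroup G] {Ω : Set (Eu d)}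
    (hb : IsBounded Ω) {r : ℝ} {K : Eu d → Eu d → G}
    (hc : Continuous (fun p : Eu d × Eu d => K p.1 p.2))
    (hs : ∀ x ∈ Ω, ∀ z, r < ‖z‖ → K x z = 0) :
    ∃ κ : ℝ, 0 ≤ κ ∧ ∀ x ∈ Ω, ∀ z, ‖K x z‖ ≤ κ := by
  have hcomp : IsCompact (closure Ω ×ˢ Metric.closedBall (0 : Eu d) r) :=
    hb.isCompact_closure.prod (isCompact_closedBall _ _)
  obtain ⟨κ, hκ⟩ := hcomp.exists_bound_of_continuousOn hc.continuousOn
  refine ⟨max κ 0, le_max_right _ _, fun x hx z => ?_⟩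
  by_cases hz : r < ‖z‖
  · rw [hs x hx z hz, norm_zero]; exact le_max_right _ _
  · exact (hκ (x, z) ⟨subset_closure hx, by simpa using not_lt.1 hz⟩).trans (le_max_left _ _)

theorem continuous_integral_kernel {d : ℕ} {Ω : Set (Eu d)} (hm : MeasurableSet Ω)
    (hb : IsBounded Ω) {r : ℝ} {K : Eu d → Eu d → ℝ}
    (hc : Continuous (fun p : Eu d × Eu d => K p.1 p.2))
    (hs : ∀ x ∈ Ω, ∀ z, r < ‖z‖ → K x z = 0) {w : Eu d → ℝ} (hw : IntegrableOn w Ω) :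
    Continuous (kint Ω w K) := by
  obtain ⟨κ, _, hκ⟩ := exists_bound_of_continuous hb hc hs
  refine continuous_of_dominated (bound := fun x => ‖w x‖ * κ) (fun z => ?_) (fun z => ?_)
    (hw.norm.mul_const κ) ?_
  · exact hw.aestronglyMeasurable.mul
      (hc.comp (by fun_prop : Continuous fun x : Eu d => (x, z))).aestronglyMeasurable
  · filter_upwards [ae_restrict_mem hm] with x hx
    rw [norm_mul]
    exact mul_le_mul_of_nonneg_left (hκ x hx z) (norm_nonneg _)
  · exact Eventually.of_forall fun x => continuous_const.mul
      (hc.comp (by fun_prop : Continuous fun z : Eu d => (x, z)))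

theorem integrableOn_mul_kernel {d : ℕ} {Ω : Set (Eu d)} (hm : MeasurableSet Ω)
    (hb : IsBounded Ω) {r : ℝ} {K : Eu d → Eu d → ℝ}
    (hc : Continuous (fun p : Eu d × Eu d => K p.1 p.2))
    (hs : ∀ x ∈ Ω, ∀ z, r < ‖z‖ → K x z = 0) {w : Eu d → ℝ} (hw : IntegrableOn w Ω) (z : Eu d) :
    IntegrableOn (fun x => w x * K x z) Ω := by
  obtain ⟨κ, _, hκ⟩ := exists_bound_of_continuous hb hc hs
  refine Integrable.mono' (hw.norm.mul_const κ) ?_ ?_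
  · exact hw.aestronglyMeasurable.mul
      (hc.comp (by fun_prop : Continuous fun x : Eu d => (x, z))).aestronglyMeasurable
  · filter_upwards [ae_restrict_mem hm] with x hx
    rw [norm_mul]
    exact mul_le_mul_of_nonneg_left (hκ x hx z) (norm_nonneg _)

theorem kint_eq_zero {d : ℕ} {Ω : Set (Eu d)} (hm : MeasurableSet Ω) {r : ℝ}
    {K : Eu d → Eu d → ℝ} (hs : ∀ x ∈ Ω, ∀ z, r < ‖z‖ → K x z = 0) (w : Eu d → ℝ) {z : Eu d}
    (hz : r < ‖z‖) : kint Ω w K z = 0 := by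
  unfold kint
  rw [setIntegral_congr_fun hm (g := fun _ => (0 : ℝ)) fun x hx => by simp [hs x hx z hz]]
  simp

theorem hasCompactSupport_of_norm_lt {d : ℕ} {r : ℝ} {f : Eu d → ℝ}
    (h : ∀ z, r < ‖z‖ → f z = 0) : HasCompactSupport f :=
  HasCompactSupport.intro (isCompact_closedBall 0 r) fun z hz => h z (by simpa using hz)

namespace RegKernel

variable {d : ℕ} {Ω : Set (Eu d)} {r : ℝ} {K : Eu d → Eu d → ℝ}

theorem fderiv_smooth (hK : RegKernel Ω r K) :
    ContDiff ℝ (⊤ : ℕ∞) (fun p : Eu d × Eu d => fderiv ℝ (K p.1) p.2) := by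
  have hsm : ContDiff ℝ (⊤ : ℕ∞) (Function.uncurry fun (p : Eu d × Eu d) z => K p.1 z) :=
    hK.smooth.comp ((contDiff_fst.comp contDiff_fst).prodMk contDiff_snd)
  exact hsm.fderiv contDiff_snd (by simp)

theorem fderiv_supp (hK : RegKernel Ω r K) : ∀ x ∈ Ω, ∀ z, r < ‖z‖ → fderiv ℝ (K x) z = 0 := by
  intro x hx z hz
  have : K x =ᶠ[𝓝 z] fun _ => 0 := by
    filter_upwards [(isOpen_lt continuous_const continuous_norm).mem_nhds hz] with y hy
    exact hK.supp x hx y hy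
  rw [this.fderiv_eq]; simp

theorem partialE (hK : RegKernel Ω r K) (k : Fin d) :
    RegKernel Ω r (fun x => partialE k (K x)) where
  smooth := hK.fderiv_smooth.clm_apply contDiff_const
  supp x hx z hz := by simp [_root_.partialE, hK.fderiv_supp x hx z hz]

theorem add {K' : Eu d → Eu d → ℝ} (hK : RegKernel Ω r K) (hK' : RegKernel Ω r K') :
    RegKernel Ω r (fun x z => K x z + K' x z) where
  smooth := hK.smooth.add hK'.smooth
  supp x hx z hz := by simp [hK.supp x hx z hz, hK'.supp x hx z hz]

theorem sum {ι : Type*} {s : Finset ι} {L : ι → Eu d → Eu d → ℝ}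
    (hL : ∀ i ∈ s, RegKernel Ω r (L i)) : RegKernel Ω r (fun x z => ∑ i ∈ s, L i x z) where
  smooth := ContDiff.sum fun i hi => (hL i hi).smooth
  supp x hx z hz := Finset.sum_eq_zero fun i hi => (hL i hi).supp x hx z hz

theorem continuous_kint (hK : RegKernel Ω r K) (hm : MeasurableSet Ω) (hb : IsBounded Ω)
    {w : Eu d → ℝ} (hw : IntegrableOn w Ω) : Continuous (kint Ω w K) :=
  continuous_integral_kernel hm hb hK.smooth.continuous hK.supp hw

theorem hasCompactSupport_kint (hK : RegKernel Ω r K) (hm : MeasurableSet Ω) (w : Eu d → ℝ) :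
    HasCompactSupport (kint Ω w K) :=
  hasCompactSupport_of_norm_lt fun _ hz => kint_eq_zero hm hK.supp w hz

theorem hasFDerivAt_kint (hK : RegKernel Ω r K) (hm : MeasurableSet Ω) (hb : IsBounded Ω)
    {w : Eu d → ℝ} (hw : IntegrableOn w Ω) (z : Eu d) :
    IntegrableOn (fun x => w x • fderiv ℝ (K x) z) Ω ∧
    HasFDerivAt (kint Ω w K) (∫ x in Ω, w x • fderiv ℝ (K x) z) z := by
  obtain ⟨κ, _, hκ⟩ := exists_bound_of_continuous hb hK.fderiv_smooth.continuous hK.fderiv_supp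
  have hcz : ∀ z, Continuous fun x : Eu d => K x z := fun z =>
    hK.smooth.continuous.comp (by fun_prop : Continuous fun x : Eu d => (x, z))
  have hm' : AEStronglyMeasurable (fun x => w x • fderiv ℝ (K x) z) (volume.restrict Ω) :=
    hw.aestronglyMeasurable.smul (hK.fderiv_smooth.continuous.comp
      (by fun_prop : Continuous fun x : Eu d => (x, z))).aestronglyMeasurable
  have hbd : ∀ᵐ x ∂volume.restrict Ω, ∀ z, ‖w x • fderiv ℝ (K x) z‖ ≤ ‖w x‖ * κ := by
    filter_upwards [ae_restrict_mem hm] with x hx z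
    rw [norm_smul]
    exact mul_le_mul_of_nonneg_left (hκ x hx z) (norm_nonneg _)
  refine ⟨(hw.norm.mul_const κ).mono' hm' (hbd.mono fun x h => h z), ?_⟩
  refine hasFDerivAt_integral_of_dominated_of_fderiv_le (s := univ)
    (bound := fun x => ‖w x‖ * κ) (F' := fun z x => w x • fderiv ℝ (K x) z) univ_mem
    (Eventually.of_forall fun z => hw.aestronglyMeasurable.mul (hcz z).aestronglyMeasurable)
    (integrableOn_mul_kernel hm hb hK.smooth.continuous hK.supp hw z) hm'
    (hbd.mono fun x h z _ => h z) (hw.norm.mul_const κ) ?_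
  refine Eventually.of_forall fun x z _ => ?_
  have : DifferentiableAt ℝ (K x) z :=
    ((hK.smooth.comp (contDiff_const.prodMk contDiff_id)).differentiable (by simp)) z
  exact this.hasFDerivAt.const_smul (w x)

theorem differentiable_kint (hK : RegKernel Ω r K) (hm : MeasurableSet Ω) (hb : IsBounded Ω)
    {w : Eu d → ℝ} (hw : IntegrableOn w Ω) : Differentiable ℝ (kint Ω w K) := fun z =>
  (hK.hasFDerivAt_kint hm hb hw z).2.differentiableAt

theorem partialE_kint (hK : RegKernel Ω r K) (hm : MeasurableSet Ω) (hb : IsBounded Ω)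
    {w : Eu d → ℝ} (hw : IntegrableOn w Ω) (k : Fin d) :
    _root_.partialE k (kint Ω w K) = kint Ω w (fun x => _root_.partialE k (K x)) := by
  ext z
  obtain ⟨h1, h2⟩ := hK.hasFDerivAt_kint hm hb hw z
  unfold _root_.partialE
  rw [h2.fderiv, ContinuousLinearMap.integral_apply h1]
  rfl

theorem kint_add {K' : Eu d → Eu d → ℝ} (hK : RegKernel Ω r K) (hK' : RegKernel Ω r K')
    (hm : MeasurableSet Ω) (hb : IsBounded Ω) {w : Eu d → ℝ} (hw : IntegrableOn w Ω) (z : Eu d) :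
    kint Ω w (fun x z => K x z + K' x z) z = kint Ω w K z + kint Ω w K' z := by
  unfold kint
  rw [← integral_add (integrableOn_mul_kernel hm hb hK.smooth.continuous hK.supp hw z)
    (integrableOn_mul_kernel hm hb hK'.smooth.continuous hK'.supp hw z)]
  simp_rw [mul_add]

theorem kint_sum {ι : Type*} {s : Finset ι} {L : ι → Eu d → Eu d → ℝ}
    (hL : ∀ i ∈ s, RegKernel Ω r (L i))
    (hm : MeasurableSet Ω) (hb : IsBounded Ω) {w : Eu d → ℝ} (hw : IntegrableOn w Ω) (z : Eu d) :
    kint Ω w (fun x z => ∑ i ∈ s, L i x z) z = ∑ i ∈ s, kint Ω w (L i) z := by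
  unfold kint
  rw [← integral_finsetSum _ fun i hi =>
    integrableOn_mul_kernel hm hb (hL i hi).smooth.continuous (hL i hi).supp hw z]
  simp_rw [Finset.mul_sum]

end RegKernel

/-- The integral operator with kernel `K` maps `L²(Ω)` to `L²(ℝ^d)` with squared norm
at most `C`. -/
def SchurBound {d : ℕ} (Ω : Set (Eu d)) (C : ℝ) (K : Eu d → Eu d → ℝ) : Prop :=
  ∀ w : Eu d → ℝ, Measurable w → IntegrableOn (fun x => w x ^ 2) Ω →
    ∫ z, kint Ω w K z ^ 2 ≤ C * ∫ x in Ω, w x ^ 2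

/-- A smoothing kernel `h` on `Ω × ℝ^d` which satisfies the Neumann condition in its first
variable and intertwines, up to a bounded error, the Laplacian on `Ω` with a uniformly elliptic
operator `div (A ∇ ·)` in divergence form on `ℝ^d`. -/
structure EnergyKernel {d : ℕ} (ζ : Eu d → ℝ) (Ω : Set (Eu d)) (C ε r : ℝ)
    (h : Eu d → Eu d → ℝ) (P : Fin d → Eu d → Eu d → ℝ) (f : Eu d → Eu d → ℝ)
    (A : Fin d → Fin d → Eu d → ℝ) : Prop where
  reg : RegKernel Ω r h
  reg_flux : ∀ k, RegKernel Ω r (P k)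
  reg_zero : RegKernel Ω r f
  neumann : ∀ z, ∀ x ∈ frontier Ω, fderiv ℝ (fun y => h y z) x (unitNormal ζ x) = 0
  lap : ∀ x ∈ Ω, ∀ z, lapE (fun y => h y z) x = ∑ k, partialE k (P k x) z + f x z
  cont : ∀ k l, Continuous (A k l)
  elliptic : ∀ z, ∀ ξ : Fin d → ℝ,
    (1 / 2) * ∑ k, ξ k ^ 2 ≤ ∑ k, ξ k * ∑ l, A k l z * ξ l
  schur : SchurBound Ω C h
  schur_zero : SchurBound Ω C f
  schur_error : ∀ k, SchurBound Ω C
    (fun x z => ∑ l, A k l z * partialE l (h x) z - P k x z)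
  approx : ∀ (F : Eu d → ℝ) (L : ℝ), 0 ≤ L → (∀ x y, |F x - F y| ≤ L * ‖x - y‖) →
    (∀ z ∉ Ω, F z = 0) → ∀ x ∈ Ω, |(∫ z, h x z * F z) - F x| ≤ C * L * ε

/-- The energy inequality for `v`, `p = ∇ v`, flux `Q = A p - e` and zero order term `g`. -/
theorem energy_inequality {d : ℕ} {v g : Eu d → ℝ} {p Q dQ e : Fin d → Eu d → ℝ} {N : ℝ}
    (vc : Continuous v) (vs : HasCompactSupport v)
    (pc : ∀ k, Continuous (p k)) (ps : ∀ k, HasCompactSupport (p k))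
    (Qc : ∀ k, Continuous (Q k)) (dQc : ∀ k, Continuous (dQ k))
    (gc : Continuous g) (gs : HasCompactSupport g)
    (ec : ∀ k, Continuous (e k)) (es : ∀ k, HasCompactSupport (e k))
    (hell : ∀ z, (1 / 2) * ∑ k, p k z ^ 2 ≤ ∑ k, p k z * (Q k z + e k z))
    (ibp : ∀ k, ∫ z, v z * dQ k z = -∫ z, p k z * Q k z)
    (hvN : ∫ z, v z ^ 2 ≤ N) (hgN : ∫ z, g z ^ 2 ≤ N) (heN : ∀ k, ∫ z, e k z ^ 2 ≤ N) :
    ∫ z, v z * (∑ k, dQ k z + g z) ≤ -(1 / 4) * (∫ z, ∑ k, p k z ^ 2) + (d + 1) * N := by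
  have sq_int : ∀ φ : Eu d → ℝ, Continuous φ → HasCompactSupport φ →
      Integrable (fun z => φ z ^ 2) := fun φ hc hs => by
    simp_rw [pow_two]
    exact (hc.mul hc).integrable_of_hasCompactSupport hs.mul_right
  have ivdQ : ∀ k ∈ (Finset.univ : Finset (Fin d)), Integrable (fun z => v z * dQ k z) :=
    fun k _ => (vc.mul (dQc k)).integrable_of_hasCompactSupport vs.mul_right
  have ipQ : ∀ k ∈ (Finset.univ : Finset (Fin d)), Integrable (fun z => p k z * Q k z) :=
    fun k _ => ((pc k).mul (Qc k)).integrable_of_hasCompactSupport (ps k).mul_right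
  have ivg : Integrable (fun z => v z * g z) :=
    (vc.mul gc).integrable_of_hasCompactSupport vs.mul_right
  have ip2 : ∀ k ∈ (Finset.univ : Finset (Fin d)), Integrable (fun z => p k z ^ 2) :=
    fun k _ => sq_int _ (pc k) (ps k)
  have ie2 : ∀ k ∈ (Finset.univ : Finset (Fin d)), Integrable (fun z => e k z ^ 2) :=
    fun k _ => sq_int _ (ec k) (es k)
  have iv2 := sq_int v vc vs
  have ig2 := sq_int g gc gs
  have ip2s := integrable_finsetSum _ ip2
  have ie2s := integrable_finsetSum _ ie2
  have ipQs := integrable_finsetSum _ ipQ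
  have inQ : Integrable (fun z => -(∑ k, p k z * Q k z)) := ipQs.neg
  have step1 : ∫ z, v z * (∑ k, dQ k z + g z) = ∫ z, (-(∑ k, p k z * Q k z) + v z * g z) := by
    simp_rw [mul_add, Finset.mul_sum]
    rw [integral_add (integrable_finsetSum _ ivdQ) ivg, integral_add inQ ivg,
      integral_finsetSum _ ivdQ, integral_neg, integral_finsetSum _ ipQ, ← Finset.sum_neg_distrib]
    simp_rw [ibp]
  have pt : ∀ z, -(∑ k, p k z * Q k z) + v z * g z
      ≤ -(1 / 4) * (∑ k, p k z ^ 2) + ∑ k, e k z ^ 2 + (1 / 2) * v z ^ 2 + (1 / 2) * g z ^ 2 := by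
    intro z
    have h1 : ∑ k, p k z * (Q k z + e k z) = ∑ k, p k z * Q k z + ∑ k, p k z * e k z := by
      simp_rw [mul_add, Finset.sum_add_distrib]
    have h2 : ∑ k, p k z * e k z ≤ (1 / 4) * ∑ k, p k z ^ 2 + ∑ k, e k z ^ 2 := by
      rw [Finset.mul_sum, ← Finset.sum_add_distrib]
      refine Finset.sum_le_sum fun k _ => ?_
      nlinarith [sq_nonneg (p k z / 2 - e k z)]
    have h3 := hell z
    have h4 : v z * g z ≤ (1 / 2) * v z ^ 2 + (1 / 2) * g z ^ 2 := by
      nlinarith [sq_nonneg (v z - g z)]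
    linarith
  have j1 : Integrable (fun z => -(1 / 4) * (∑ k, p k z ^ 2) + ∑ k, e k z ^ 2) :=
    (ip2s.const_mul _).add ie2s
  have j2 : Integrable (fun z => -(1 / 4) * (∑ k, p k z ^ 2) + ∑ k, e k z ^ 2
      + (1 / 2) * v z ^ 2) := j1.add (iv2.const_mul _)
  have j3 : Integrable (fun z => -(1 / 4) * (∑ k, p k z ^ 2) + ∑ k, e k z ^ 2
      + (1 / 2) * v z ^ 2 + (1 / 2) * g z ^ 2) := j2.add (ig2.const_mul _)
  rw [step1]
  refine (integral_mono (inQ.add ivg) j3 pt).trans ?_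
  rw [integral_add j2 (ig2.const_mul _), integral_add j1 (iv2.const_mul _),
    integral_add (ip2s.const_mul _) ie2s, integral_const_mul, integral_const_mul,
    integral_const_mul, integral_finsetSum _ ie2]
  have b3 : ∑ k, ∫ z, e k z ^ 2 ≤ d * N := by
    refine (Finset.sum_le_sum fun k _ => heN k).trans ?_
    simp
  linarith

namespace EnergyKernel

variable {d : ℕ} {ζ : Eu d → ℝ} {Ω : Set (Eu d)} {C ε r : ℝ} {h : Eu d → Eu d → ℝ}
  {P : Fin d → Eu d → Eu d → ℝ} {f : Eu d → Eu d → ℝ} {A : Fin d → Fin d → Eu d → ℝ}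

theorem energy_le (H : EnergyKernel ζ Ω C ε r h P f A) (hm : MeasurableSet Ω) (hb : IsBounded Ω)
    {w : Eu d → ℝ} (hw : Measurable w) (hw2 : IntegrableOn (fun x => w x ^ 2) Ω) :
    ∫ z, kint Ω w h z * kint Ω w (fun x z => ∑ k, partialE k (P k x) z + f x z) z
      ≤ -(1 / 4) * (∫ z, ∑ k, kint Ω w (fun x => partialE k (h x)) z ^ 2)
        + (d + 1) * (C * ∫ x in Ω, w x ^ 2) := by
  have hwi : IntegrableOn w Ω := integrableOn_of_sq hb hw hw2
  have pc : ∀ k, Continuous (kint Ω w (fun x => partialE k (h x))) := fun k =>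
    (H.reg.partialE k).continuous_kint hm hb hwi
  have Qc : ∀ k, Continuous (kint Ω w (P k)) := fun k =>
    (H.reg_flux k).continuous_kint hm hb hwi
  have hek : ∀ k z, kint Ω w (fun x z => ∑ l, A k l z * partialE l (h x) z - P k x z) z
      = ∑ l, A k l z * kint Ω w (fun x => partialE l (h x)) z - kint Ω w (P k) z := by
    intro k z
    have i1 : ∀ l ∈ (Finset.univ : Finset (Fin d)),
        Integrable (fun x => w x * (A k l z * partialE l (h x) z)) (volume.restrict Ω) := by
      intro l _
      have := (integrableOn_mul_kernel hm hb (H.reg.partialE l).smooth.continuous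
        (H.reg.partialE l).supp hwi z).const_mul (A k l z)
      refine this.congr (Eventually.of_forall fun x => ?_)
      simp only; ring
    unfold kint
    simp_rw [mul_sub, Finset.mul_sum]
    rw [integral_sub (integrable_finsetSum _ i1) (integrableOn_mul_kernel hm hb
      (H.reg_flux k).smooth.continuous (H.reg_flux k).supp hwi z), integral_finsetSum _ i1]
    congr 1
    refine Finset.sum_congr rfl fun l _ => ?_
    rw [← integral_const_mul]
    congr 1
    ext x
    ring
  have hq : ∀ z, kint Ω w (fun x z => ∑ k, partialE k (P k x) z + f x z) z
      = ∑ k, partialE k (kint Ω w (P k)) z + kint Ω w f z := by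
    intro z
    have rk : ∀ k ∈ (Finset.univ : Finset (Fin d)), RegKernel Ω r (fun x => partialE k (P k x)) :=
      fun k _ => (H.reg_flux k).partialE k
    rw [(RegKernel.sum rk).kint_add H.reg_zero hm hb hwi, RegKernel.kint_sum rk hm hb hwi]
    congr 1
    refine Finset.sum_congr rfl fun k _ => ?_
    rw [(H.reg_flux k).partialE_kint hm hb hwi]
  have dQc : ∀ k, Continuous (partialE k (kint Ω w (P k))) := fun k => by
    rw [(H.reg_flux k).partialE_kint hm hb hwi]
    exact ((H.reg_flux k).partialE k).continuous_kint hm hb hwi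
  have vc := H.reg.continuous_kint hm hb hwi
  have vs := H.reg.hasCompactSupport_kint hm w
  have ibp : ∀ k, ∫ z, kint Ω w h z * partialE k (kint Ω w (P k)) z
      = -∫ z, kint Ω w (fun x => partialE k (h x)) z * kint Ω w (P k) z := by
    intro k
    rw [← H.reg.partialE_kint hm hb hwi k]
    refine integral_mul_fderiv_eq_neg_fderiv_mul_of_integrable ?_
      ((vc.mul (dQc k)).integrable_of_hasCompactSupport vs.mul_right)
      ((vc.mul (Qc k)).integrable_of_hasCompactSupport vs.mul_right)
      (fun z _ => H.reg.differentiable_kint hm hb hwi z)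
      (fun z _ => (H.reg_flux k).differentiable_kint hm hb hwi z)
    change Integrable fun z => partialE k (kint Ω w h) z * kint Ω w (P k) z
    rw [H.reg.partialE_kint hm hb hwi k]
    exact ((pc k).mul (Qc k)).integrable_of_hasCompactSupport
      ((H.reg.partialE k).hasCompactSupport_kint hm w).mul_right
  simp_rw [hq]
  refine energy_inequality vc vs pc (fun k => (H.reg.partialE k).hasCompactSupport_kint hm w) Qc dQc
    (H.reg_zero.continuous_kint hm hb hwi) (H.reg_zero.hasCompactSupport_kint hm w)
    (e := fun k => kint Ω w (fun x z => ∑ l, A k l z * partialE l (h x) z - P k x z))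
    (fun k => ?_) (fun k => ?_) (fun z => ?_) ibp (H.schur w hw hw2) (H.schur_zero w hw hw2)
    (fun k => H.schur_error k w hw hw2)
  · simp_rw [funext (hek k)]
    exact (continuous_finsetSum _ fun l _ => (H.cont k l).mul (pc l)).sub (Qc k)
  · refine hasCompactSupport_of_norm_lt (r := r) fun z hz => kint_eq_zero hm ?_ w hz
    intro x hx y hy
    rw [(H.reg_flux k).supp x hx y hy, sub_zero]
    exact Finset.sum_eq_zero fun l _ => by rw [(H.reg.partialE l).supp x hx y hy, mul_zero]
  · refine (H.elliptic z _).trans (Finset.sum_le_sum fun k _ => ?_)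
    rw [hek, add_sub_cancel]

end EnergyKernel

theorem lapE_const_mul {d : ℕ} {f : Eu d → ℝ} (hf : ContDiff ℝ (⊤ : ℕ∞) f) (c : ℝ) (x : Eu d) :
    lapE (fun y => c * f y) x = c * lapE f x := by
  unfold lapE
  rw [Finset.mul_sum]
  refine Finset.sum_congr rfl fun i _ => ?_
  have h1 : (fun y => fderiv ℝ (fun y => c * f y) y (basisE d i))
      = fun y => c * fderiv ℝ f y (basisE d i) := by
    ext y
    rw [fderiv_const_mul (hf.differentiable (by simp) y)]
    simp
  have h2 : ContDiff ℝ (⊤ : ℕ∞) (fun y => fderiv ℝ f y (basisE d i)) :=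
    (hf.fderiv_right (by simp)).clm_apply contDiff_const
  rw [h1, fderiv_const_mul (h2.differentiable (by simp) x)]
  simp

section Slices

variable {d : ℕ} {Ω : Set (Eu d)} {r : ℝ} {K : Eu d → Eu d → ℝ} {ρ : ℝ → Eu d → ℝ}
  {μ : Measure ℝ}

theorem RegKernel.measurable_kint (hK : RegKernel Ω r K)
    (hρ : Measurable (fun p : ℝ × Eu d => ρ p.1 p.2)) :
    StronglyMeasurable (fun p : ℝ × Eu d => kint Ω (ρ p.1) K p.2) := by
  have h1 : Measurable (fun q : (ℝ × Eu d) × Eu d => ρ q.1.1 q.2 * K q.2 q.1.2) :=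
    (hρ.comp (by fun_prop : Measurable fun q : (ℝ × Eu d) × Eu d => (q.1.1, q.2))).mul
      (hK.smooth.continuous.measurable.comp
        (by fun_prop : Measurable fun q : (ℝ × Eu d) × Eu d => (q.2, q.1.2)))
  exact h1.stronglyMeasurable.integral_prod_right

theorem ae_integrableOn_sq [SFinite μ]
    (hρ2 : Integrable (fun p : ℝ × Eu d => ρ p.1 p.2 ^ 2) (μ.prod (volume.restrict Ω))) :
    ∀ᵐ t ∂μ, IntegrableOn (fun x => ρ t x ^ 2) Ω := hρ2.prod_right_ae

theorem RegKernel.memLp_kint (hK : RegKernel Ω r K) (hm : MeasurableSet Ω) (hb : IsBounded Ω)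
    [SFinite μ] (hρ : Measurable (fun p : ℝ × Eu d => ρ p.1 p.2))
    (hρ2 : Integrable (fun p : ℝ × Eu d => ρ p.1 p.2 ^ 2) (μ.prod (volume.restrict Ω))) :
    MemLp (fun p : ℝ × Eu d => kint Ω (ρ p.1) K p.2) 2 (μ.prod volume) := by
  have hfin : IsFiniteMeasure (volume.restrict Ω) :=
    isFiniteMeasure_restrict.2 hb.measure_lt_top.ne
  obtain ⟨κ, hκ0, hκ⟩ := exists_bound_of_continuous hb hK.smooth.continuous hK.supp
  rw [memLp_two_iff_integrable_sq (hK.measurable_kint hρ).aestronglyMeasurable]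
  have hdom : Integrable (fun p : ℝ × Eu d => (∫ x in Ω, ρ p.1 x ^ 2) *
      (Metric.closedBall (0 : Eu d) r).indicator (fun _ => κ ^ 2 * volume.real Ω) p.2)
      (μ.prod volume) := by
    refine Integrable.mul_prod (μ := μ) (ν := volume) hρ2.integral_prod_left ?_
    rw [integrable_indicator_iff Metric.isClosed_closedBall.measurableSet]
    exact integrableOn_const measure_closedBall_lt_top.ne
  refine hdom.mono' ((hK.measurable_kint hρ).pow 2).aestronglyMeasurable ?_
  have hae := Measure.quasiMeasurePreserving_fst (μ := μ) (ν := (volume : Measure (Eu d)))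
    |>.ae (ae_integrableOn_sq hρ2)
  filter_upwards [hae] with p hp
  have hmt : Measurable (ρ p.1) := hρ.comp measurable_prodMk_left
  rw [norm_of_nonneg (sq_nonneg _)]
  by_cases hz : r < ‖p.2‖
  · rw [kint_eq_zero hm hK.supp _ hz]
    simp [hz]
  · rw [indicator_of_mem (by simpa using hz)]
    have hKc : Continuous fun x => K x p.2 :=
      hK.smooth.continuous.comp (by fun_prop : Continuous fun x : Eu d => (x, p.2))
    have hKbd : ∀ᵐ x ∂volume.restrict Ω, K x p.2 ^ 2 ≤ κ ^ 2 := by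
      filter_upwards [ae_restrict_mem hm] with x hx
      exact sq_le_sq' (by linarith [(abs_le.1 (hκ x hx p.2)).1]) (abs_le.1 (hκ x hx p.2)).2
    have hK2 : Integrable (fun x => K x p.2 ^ 2) (volume.restrict Ω) := by
      refine (integrable_const (κ ^ 2)).mono' (hKc.pow 2).aestronglyMeasurable ?_
      filter_upwards [hKbd] with x hx
      rwa [norm_of_nonneg (sq_nonneg _)]
    refine (sq_integral_mul_le hp hK2 (integrableOn_mul_kernel hm hb hK.smooth.continuous hK.supp
      (integrableOn_of_sq hb hmt hp) p.2)).trans ?_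
    refine mul_le_mul_of_nonneg_left ?_ (integral_nonneg fun _ => sq_nonneg _)
    refine (integral_mono_ae hK2 (integrable_const _) hKbd).trans ?_
    simp [mul_comm]

theorem RegKernel.integrable_kint_slice (hK : RegKernel Ω r K) (hm : MeasurableSet Ω)
    (hb : IsBounded Ω) [SFinite μ]
    (hρ1 : Integrable (fun p : ℝ × Eu d => ρ p.1 p.2) (μ.prod (volume.restrict Ω))) (z : Eu d) :
    Integrable (fun t => kint Ω (ρ t) K z) μ := by
  obtain ⟨κ, hκ0, hκ⟩ := exists_bound_of_continuous hb hK.smooth.continuous hK.supp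
  have hKc : Continuous fun x => K x z :=
      hK.smooth.continuous.comp (by fun_prop : Continuous fun x : Eu d => (x, z))
  have : Integrable (fun p : ℝ × Eu d => ρ p.1 p.2 * K p.2 z) (μ.prod (volume.restrict Ω)) := by
    refine (hρ1.norm.mul_const κ).mono' (hρ1.aestronglyMeasurable.mul
      (hKc.comp continuous_snd).aestronglyMeasurable) ?_
    have hae := Measure.quasiMeasurePreserving_snd (μ := μ) (ν := (volume.restrict Ω))
      |>.ae (ae_restrict_mem hm)
    filter_upwards [hae] with p hp
    rw [norm_mul]
    exact mul_le_mul_of_nonneg_left (hκ _ hp z) (norm_nonneg _)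
  exact this.integral_prod_left

end Slices

/-- The weak formulation of the Neumann heat equation on `(0,T) × Ω`. -/
def WeakHeat {d : ℕ} (T : ℝ) (ζ : Eu d → ℝ) (Ω : Set (Eu d)) (ρ : ℝ → Eu d → ℝ)
    (ρin : Eu d → ℝ) : Prop :=
  ∀ ψ : ℝ → Eu d → ℝ,
    ContDiff ℝ (⊤ : ℕ∞) (fun p : ℝ × Eu d => ψ p.1 p.2) →
    (∀ x, ψ T x = 0) →
    (∀ t ∈ Ioo (0 : ℝ) T, ∀ x ∈ frontier Ω,
      fderiv ℝ (fun y => ψ t y) x (unitNormal ζ x) = 0) →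
    (∫ t in Ioo (0 : ℝ) T, ∫ x in Ω,
        ρ t x * (deriv (fun s => ψ s x) t + lapE (fun y => ψ t y) x))
      + (∫ x in Ω, ρin x * ψ 0 x) = 0

namespace EnergyKernel

variable {d : ℕ} {T : ℝ} {ζ : Eu d → ℝ} {Ω : Set (Eu d)} {C ε r : ℝ} {h : Eu d → Eu d → ℝ}
  {P : Fin d → Eu d → Eu d → ℝ} {f : Eu d → Eu d → ℝ} {A : Fin d → Fin d → Eu d → ℝ}
  {ρ : ℝ → Eu d → ℝ} {ρin : Eu d → ℝ}

theorem reg_lap (H : EnergyKernel ζ Ω C ε r h P f A) :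
    RegKernel Ω r (fun x z => ∑ k, partialE k (P k x) z + f x z) :=
  (RegKernel.sum (s := Finset.univ) fun k _ => (H.reg_flux k).partialE k).add H.reg_zero

theorem neg_half_sq_le (H : EnergyKernel ζ Ω C ε r h P f A) (hT : 0 < T) (hm : MeasurableSet Ω)
    (hb : IsBounded Ω) (hρ1 : Integrable (fun p : ℝ × Eu d => ρ p.1 p.2)
      ((volume.restrict (Ioo 0 T)).prod (volume.restrict Ω)))
    (hW : WeakHeat T ζ Ω ρ ρin) (z : Eu d) :
    -(kint Ω ρin h z ^ 2) / 2 ≤ ∫ t in Ioo 0 T, kint Ω (ρ t) h z *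
      kint Ω (ρ t) (fun x z => ∑ k, partialE k (P k x) z + f x z) z := by
  refine neg_half_sq_le_integral_mul_of_weak_deriv hT (H.reg.integrable_kint_slice hm hb hρ1 z)
    (H.reg_lap.integrable_kint_slice hm hb hρ1 z) fun θ hθ hθT => ?_
  have hsm : ContDiff ℝ (⊤ : ℕ∞) (fun x => h x z) :=
    H.reg.smooth.comp (contDiff_id.prodMk contDiff_const)
  have key := hW (fun t x => θ t * h x z)
    ((hθ.comp contDiff_fst).mul (hsm.comp contDiff_snd)) (fun x => by simp [hθT])
    (fun t _ x hx => by
      rw [fderiv_const_mul (hsm.differentiable (by simp) x)]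
      simp [H.neumann z x hx])
  refine Eq.trans ?_ key
  congr 1
  · refine integral_congr_ae ?_
    filter_upwards [hρ1.prod_right_ae] with t ht
    unfold kint
    rw [← integral_const_mul, ← integral_const_mul, ← integral_add]
    · refine setIntegral_congr_fun hm fun x hx => ?_
      simp only
      rw [lapE_const_mul hsm, H.lap x hx z]
      have : deriv (fun s => θ s * h x z) t = deriv θ t * h x z :=
        deriv_mul_const (hθ.differentiable (by simp) t) _
      rw [this]
      ring
    · exact (integrableOn_mul_kernel hm hb H.reg.smooth.continuous H.reg.supp ht z).const_mul _
    · exact (integrableOn_mul_kernel hm hb H.reg_lap.smooth.continuous H.reg_lap.supp ht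
        z).const_mul _
  · unfold kint
    rw [← integral_const_mul]
    congr 1
    ext x
    ring

theorem integral_sum_sq_le (H : EnergyKernel ζ Ω C ε r h P f A) (hT : 0 < T)
    (hm : MeasurableSet Ω) (hb : IsBounded Ω)
    (hρ : Measurable (fun p : ℝ × Eu d => ρ p.1 p.2))
    (hρ2 : Integrable (fun p : ℝ × Eu d => ρ p.1 p.2 ^ 2)
      ((volume.restrict (Ioo 0 T)).prod (volume.restrict Ω)))
    (hi : Measurable ρin) (hi2 : IntegrableOn (fun x => ρin x ^ 2) Ω)
    (hW : WeakHeat T ζ Ω ρ ρin) :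
    ∫ t in Ioo 0 T, ∫ z, ∑ k, kint Ω (ρ t) (fun x => partialE k (h x)) z ^ 2 ≤
      2 * C * (∫ x in Ω, ρin x ^ 2) + 4 * ((d + 1) * C) * ∫ t in Ioo 0 T, ∫ x in Ω, ρ t x ^ 2 := by
  have hfin : IsFiniteMeasure (volume.restrict Ω) :=
    isFiniteMeasure_restrict.2 hb.measure_lt_top.ne
  have hρ1 : Integrable (fun p : ℝ × Eu d => ρ p.1 p.2)
      ((volume.restrict (Ioo 0 T)).prod (volume.restrict Ω)) :=
    ((memLp_two_iff_integrable_sq hρ.aestronglyMeasurable).2 hρ2).integrable (by norm_num)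
  have hvq : Integrable (fun p : ℝ × Eu d => kint Ω (ρ p.1) h p.2 *
      kint Ω (ρ p.1) (fun x z => ∑ k, partialE k (P k x) z + f x z) p.2)
      ((volume.restrict (Ioo 0 T)).prod volume) :=
    (H.reg.memLp_kint hm hb hρ hρ2).integrable_mul (H.reg_lap.memLp_kint hm hb hρ hρ2)
  have hp2 : Integrable (fun q : ℝ × Eu d =>
      ∑ k, kint Ω (ρ q.1) (fun x => partialE k (h x)) q.2 ^ 2)
      ((volume.restrict (Ioo 0 T)).prod volume) :=
    integrable_finsetSum _ fun k _ => ((H.reg.partialE k).memLp_kint hm hb hρ hρ2).integrable_sq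
  have hin := integrableOn_of_sq hb hi hi2
  have hv0 : Integrable (fun z => kint Ω ρin h z ^ 2) := by
    have := H.reg.continuous_kint hm hb hin
    simp_rw [pow_two]
    exact (this.mul this).integrable_of_hasCompactSupport
      (H.reg.hasCompactSupport_kint hm ρin).mul_right
  have hlow : -(C / 2 * ∫ x in Ω, ρin x ^ 2) ≤ ∫ z, ∫ t in Ioo 0 T, kint Ω (ρ t) h z *
      kint Ω (ρ t) (fun x z => ∑ k, partialE k (P k x) z + f x z) z := by
    have h1 : Integrable (fun z => -(kint Ω ρin h z ^ 2) / 2) := hv0.neg.div_const 2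
    have h2 := integral_mono h1 hvq.integral_prod_right
      (fun z => H.neg_half_sq_le hT hm hb hρ1 hW z)
    have h3 : ∫ z, -(kint Ω ρin h z ^ 2) / 2 = -(∫ z, kint Ω ρin h z ^ 2) / 2 := by
      rw [integral_div, integral_neg]
    have h4 := H.schur ρin hi hi2
    rw [h3] at h2
    linarith
  rw [← integral_integral_swap (f := fun t z => kint Ω (ρ t) h z *
      kint Ω (ρ t) (fun x z => ∑ k, partialE k (P k x) z + f x z) z) hvq] at hlow
  have i1 : Integrable (fun t => -(1 / 4) *
      (∫ z, ∑ k, kint Ω (ρ t) (fun x => partialE k (h x)) z ^ 2)) (volume.restrict (Ioo 0 T)) :=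
    hp2.integral_prod_left.const_mul _
  have i2 : Integrable (fun t => (d + 1) * (C * ∫ x in Ω, ρ t x ^ 2))
      (volume.restrict (Ioo 0 T)) := (hρ2.integral_prod_left.const_mul _).const_mul _
  have hup := integral_mono_ae hvq.integral_prod_left (i1.add i2) (by
    filter_upwards [ae_integrableOn_sq hρ2] with t ht
    exact H.energy_le hm hb (hρ.comp measurable_prodMk_left) ht)
  have e : ∫ t in Ioo 0 T, ((fun t => -(1 / 4) *
      (∫ z, ∑ k, kint Ω (ρ t) (fun x => partialE k (h x)) z ^ 2)) +
      (fun t => (d + 1) * (C * ∫ x in Ω, ρ t x ^ 2))) t = -(1 / 4) * (∫ t in Ioo 0 T,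
      (∫ z, ∑ k, kint Ω (ρ t) (fun x => partialE k (h x)) z ^ 2)) +
      (d + 1) * (C * ∫ t in Ioo 0 T, ∫ x in Ω, ρ t x ^ 2) := by
    rw [integral_add' i1 i2, integral_const_mul, integral_const_mul, integral_const_mul]
  rw [e] at hup
  have hfinal := hlow.trans hup
  linarith

end EnergyKernel

/-- Smooth functions with compact support in `(0,T) × Ω`. -/
def testFunctions {d : ℕ} (T : ℝ) (Ω : Set (Eu d)) : Submodule ℝ (ℝ × Eu d → ℝ) where
  carrier := {u | ContDiff ℝ (⊤ : ℕ∞) u ∧ HasCompactSupport u ∧ tsupport u ⊆ Ioo 0 T ×ˢ Ω}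
  add_mem' {u v} hu hv := ⟨hu.1.add hv.1, hu.2.1.add hv.2.1,
    (tsupport_add u v).trans (union_subset hu.2.2 hv.2.2)⟩
  zero_mem' := ⟨contDiff_const, HasCompactSupport.zero, by simp [tsupport]⟩
  smul_mem' c u hu := ⟨contDiff_const.smul hu.1, hu.2.1.smul_left (f := fun _ => c),
    (tsupport_smul_subset_right (fun _ => c) u).trans hu.2.2⟩

/-- The spatial partial derivative of a function of time and space. -/
def spacePartial {d : ℕ} (i : Fin d) (u : ℝ × Eu d → ℝ) (p : ℝ × Eu d) : ℝ :=
  partialE i (fun y => u (p.1, y)) p.2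

section TestFunctions

variable {d : ℕ} {T : ℝ} {Ω : Set (Eu d)} {u : ℝ × Eu d → ℝ} (i : Fin d)

theorem spacePartial_eq (hu : ContDiff ℝ (⊤ : ℕ∞) u) (p : ℝ × Eu d) :
    spacePartial i u p = fderiv ℝ u p (0, basisE d i) := by
  have h1 : HasFDerivAt u (fderiv ℝ u p) (p.1, p.2) := (hu.differentiable (by simp) p).hasFDerivAt
  have h2 := h1.comp p.2 ((hasFDerivAt_const p.1 p.2).prodMk (hasFDerivAt_id (𝕜 := ℝ) p.2))
  have h3 : fderiv ℝ (fun y => u (p.1, y)) p.2 = _ := h2.fderiv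
  rw [spacePartial, partialE, h3]
  simp

theorem contDiff_spacePartial (hu : ContDiff ℝ (⊤ : ℕ∞) u) :
    ContDiff ℝ (⊤ : ℕ∞) (spacePartial i u) := by
  rw [funext (spacePartial_eq i hu)]
  exact (hu.fderiv_right (by simp)).clm_apply contDiff_const

theorem tsupport_spacePartial (hu : ContDiff ℝ (⊤ : ℕ∞) u) :
    tsupport (spacePartial i u) ⊆ tsupport u := by
  rw [funext (spacePartial_eq i hu)]
  refine closure_minimal (fun p hp => support_fderiv_subset ℝ ?_) (isClosed_tsupport u)
  intro h0
  simp [h0] at hp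

theorem spacePartial_add {v : ℝ × Eu d → ℝ} (hu : ContDiff ℝ (⊤ : ℕ∞) u)
    (hv : ContDiff ℝ (⊤ : ℕ∞) v) :
    spacePartial i (u + v) = spacePartial i u + spacePartial i v := by
  ext p
  rw [Pi.add_apply, spacePartial_eq i hu, spacePartial_eq i hv,
    spacePartial_eq i (u := u + v) (hu.add hv),
    fderiv_add (hu.differentiable (by simp) p) (hv.differentiable (by simp) p)]
  simp

theorem spacePartial_smul (hu : ContDiff ℝ (⊤ : ℕ∞) u) (c : ℝ) :
    spacePartial i (c • u) = c • spacePartial i u := by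
  ext p
  rw [Pi.smul_apply, spacePartial_eq i hu, spacePartial_eq i (u := c • u) (contDiff_const.smul hu),
    fderiv_const_smul (hu.differentiable (by simp) p)]
  simp

theorem exists_lipschitz_spacePartial (hu : ContDiff ℝ (⊤ : ℕ∞) u) (hc : HasCompactSupport u) :
    ∃ L : ℝ, 0 ≤ L ∧ ∀ t x y,
      |spacePartial i u (t, x) - spacePartial i u (t, y)| ≤ L * ‖x - y‖ := by
  obtain ⟨L, hL⟩ := (contDiff_spacePartial i hu).lipschitzWith_of_hasCompactSupport
    (hc.of_isClosed_subset (isClosed_tsupport _) (tsupport_spacePartial i hu)) (by simp)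
  refine ⟨L, L.2, fun t x y => ?_⟩
  have := hL.dist_le_mul (t, x) (t, y)
  rwa [Real.dist_eq, Prod.dist_eq, dist_self, max_eq_right dist_nonneg, dist_eq_norm] at this

end TestFunctions

namespace EnergyKernel

variable {d : ℕ} {T : ℝ} {ζ : Eu d → ℝ} {Ω : Set (Eu d)} {C ε r : ℝ} {h : Eu d → Eu d → ℝ}
  {P : Fin d → Eu d → Eu d → ℝ} {f : Eu d → Eu d → ℝ} {A : Fin d → Fin d → Eu d → ℝ}
  {ρ : ℝ → Eu d → ℝ} {ρin : Eu d → ℝ}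

theorem abs_integral_sub_le (H : EnergyKernel ζ Ω C ε r h P f A) (hm : MeasurableSet Ω)
    (hb : IsBounded Ω) {w F : Eu d → ℝ} (hw : IntegrableOn w Ω) (hF : Continuous F)
    (hFc : HasCompactSupport F) {L : ℝ} (hL0 : 0 ≤ L) (hL : ∀ x y, |F x - F y| ≤ L * ‖x - y‖)
    (hF0 : ∀ z ∉ Ω, F z = 0) :
    |(∫ z, kint Ω w h z * F z) - ∫ x in Ω, w x * F x| ≤ (C * L * ε) * ∫ x in Ω, |w x| := by
  have hfin : IsFiniteMeasure (volume.restrict Ω) :=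
    isFiniteMeasure_restrict.2 hb.measure_lt_top.ne
  obtain ⟨κ, hκ0, hκ⟩ := exists_bound_of_continuous hb H.reg.smooth.continuous H.reg.supp
  have hFi : Integrable F := hF.integrable_of_hasCompactSupport hFc
  have hjoint : Integrable (fun p : Eu d × Eu d => w p.2 * h p.2 p.1 * F p.1)
      (volume.prod (volume.restrict Ω)) := by
    refine ((hFi.norm.mul_prod hw.norm).mul_const κ).mono' ?_ ?_
    · refine AEStronglyMeasurable.mul (AEStronglyMeasurable.mul ?_ ?_) ?_
      · exact hw.aestronglyMeasurable.comp_snd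
      · exact (H.reg.smooth.continuous.comp
          (by fun_prop : Continuous fun p : Eu d × Eu d => (p.2, p.1))).aestronglyMeasurable
      · exact (hF.comp continuous_fst).aestronglyMeasurable
    · have hae := Measure.quasiMeasurePreserving_snd (μ := (volume : Measure (Eu d)))
        (ν := (volume.restrict Ω)) |>.ae (ae_restrict_mem hm)
      filter_upwards [hae] with p hp
      rw [norm_mul, norm_mul]
      have := mul_le_mul_of_nonneg_left (hκ _ hp p.1)
        (mul_nonneg (norm_nonneg (F p.1)) (norm_nonneg (w p.2)))
      linarith
  have hswap : ∫ z, kint Ω w h z * F z = ∫ x in Ω, w x * ∫ z, h x z * F z := by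
    have := integral_integral_swap (f := fun z x => w x * h x z * F z) hjoint
    unfold kint
    simp_rw [← integral_mul_const, this, ← integral_const_mul, mul_assoc]
  have i1 : Integrable (fun x => w x * ∫ z, h x z * F z) (volume.restrict Ω) := by
    refine hjoint.integral_prod_right.congr (Eventually.of_forall fun x => ?_)
    simp_rw [← integral_const_mul, mul_assoc]
  obtain ⟨B, hB⟩ := hFc.exists_bound_of_continuous hF
  have i2 : Integrable (fun x => w x * F x) (volume.restrict Ω) :=
    hw.mul_bdd (c := B) hF.aestronglyMeasurable (Eventually.of_forall hB)
  rw [hswap, ← integral_sub i1 i2, ← integral_const_mul, ← Real.norm_eq_abs]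
  refine norm_integral_le_of_norm_le (hw.norm.const_mul _) ?_
  filter_upwards [ae_restrict_mem hm] with x hx
  rw [← mul_sub, norm_mul, mul_comm]
  exact mul_le_mul_of_nonneg_right (H.approx F L hL0 hL hF0 x hx) (norm_nonneg _)

theorem abs_integral_spacePartial_le (H : EnergyKernel ζ Ω C ε r h P f A) (hT : 0 < T)
    (hm : MeasurableSet Ω) (hb : IsBounded Ω)
    (hρ : Measurable (fun p : ℝ × Eu d => ρ p.1 p.2))
    (hρ2 : Integrable (fun p : ℝ × Eu d => ρ p.1 p.2 ^ 2)
      ((volume.restrict (Ioo 0 T)).prod (volume.restrict Ω)))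
    (hi : Measurable ρin) (hi2 : IntegrableOn (fun x => ρin x ^ 2) Ω)
    (hW : WeakHeat T ζ Ω ρ ρin) (i : Fin d) {u : ℝ × Eu d → ℝ} (hu : u ∈ testFunctions T Ω)
    {L : ℝ} (hL0 : 0 ≤ L)
    (hL : ∀ t x y, |spacePartial i u (t, x) - spacePartial i u (t, y)| ≤ L * ‖x - y‖) :
    |∫ t in Ioo 0 T, ∫ x in Ω, ρ t x * spacePartial i u (t, x)| ≤
      √(2 * C * (∫ x in Ω, ρin x ^ 2) + 4 * ((d + 1) * C) * ∫ t in Ioo 0 T, ∫ x in Ω, ρ t x ^ 2) *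
        √(∫ p in Ioo 0 T ×ˢ Ω, u p ^ 2) +
      (C * L * ∫ t in Ioo 0 T, ∫ x in Ω, |ρ t x|) * ε := by
  obtain ⟨hus, huc, hut⟩ := hu
  have hfin : IsFiniteMeasure (volume.restrict Ω) :=
    isFiniteMeasure_restrict.2 hb.measure_lt_top.ne
  have hρ1 : Integrable (fun p : ℝ × Eu d => ρ p.1 p.2)
      ((volume.restrict (Ioo 0 T)).prod (volume.restrict Ω)) :=
    ((memLp_two_iff_integrable_sq hρ.aestronglyMeasurable).2 hρ2).integrable (by norm_num)
  have hF := (contDiff_spacePartial i hus).continuous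
  have hFt := tsupport_spacePartial i hus
  have hFc : HasCompactSupport (spacePartial i u) :=
    huc.of_isClosed_subset (isClosed_tsupport _) hFt
  have slice : ∀ {v : ℝ × Eu d → ℝ}, HasCompactSupport v → tsupport v ⊆ tsupport u → ∀ t,
      HasCompactSupport (fun x => v (t, x)) ∧ ∀ z ∉ Ω, v (t, z) = 0 := by
    intro v hv hvu t
    refine ⟨HasCompactSupport.intro (hv.image continuous_snd) fun x hx => ?_, fun z hz => ?_⟩
    · by_contra h0
      exact hx ⟨(t, x), subset_tsupport v h0, rfl⟩
    · by_contra h0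
      exact hz (hut (hvu (subset_tsupport v h0))).2
  have hFm : MemLp (spacePartial i u) 2 ((volume.restrict (Ioo 0 T)).prod volume) := by
    have : (volume.restrict (Ioo (0:ℝ) T)).prod (volume : Measure (Eu d)) ≤ volume := by
      rw [Measure.volume_eq_prod]
      exact Measure.prod_mono Measure.restrict_le_self le_rfl
    exact (hF.memLp_of_hasCompactSupport hFc).mono_measure this
  have hum : MemLp u 2 ((volume.restrict (Ioo 0 T)).prod (volume : Measure (Eu d))) := by
    have : (volume.restrict (Ioo (0:ℝ) T)).prod (volume : Measure (Eu d)) ≤ volume := by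
      rw [Measure.volume_eq_prod]
      exact Measure.prod_mono Measure.restrict_le_self le_rfl
    exact (hus.continuous.memLp_of_hasCompactSupport huc).mono_measure this
  have hpm := (H.reg.partialE i).memLp_kint hm hb hρ hρ2
  have iVF : Integrable (fun p : ℝ × Eu d => kint Ω (ρ p.1) h p.2 * spacePartial i u p)
      ((volume.restrict (Ioo 0 T)).prod volume) :=
    (H.reg.memLp_kint hm hb hρ hρ2).integrable_mul hFm
  have ipu : Integrable (fun p : ℝ × Eu d =>
      kint Ω (ρ p.1) (fun x => partialE i (h x)) p.2 * u p)
      ((volume.restrict (Ioo 0 T)).prod volume) :=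
    hpm.integrable_mul hum
  obtain ⟨B, hB⟩ := hFc.exists_bound_of_continuous hF
  have iρF : Integrable (fun p : ℝ × Eu d => ρ p.1 p.2 * spacePartial i u p)
      ((volume.restrict (Ioo 0 T)).prod (volume.restrict Ω)) :=
    hρ1.mul_bdd (c := B) hF.aestronglyMeasurable (Eventually.of_forall hB)
  have happ : |(∫ t in Ioo 0 T, ∫ z, kint Ω (ρ t) h z * spacePartial i u (t, z)) -
      ∫ t in Ioo 0 T, ∫ x in Ω, ρ t x * spacePartial i u (t, x)| ≤
      (C * L * ε) * ∫ t in Ioo 0 T, ∫ x in Ω, |ρ t x| := by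
    rw [← integral_sub iVF.integral_prod_left iρF.integral_prod_left, ← integral_const_mul,
      ← Real.norm_eq_abs]
    refine norm_integral_le_of_norm_le (hρ1.norm.integral_prod_left.const_mul _) ?_
    filter_upwards [hρ1.prod_right_ae] with t ht
    exact H.abs_integral_sub_le hm hb ht (hF.comp (Continuous.prodMk_right t))
      (slice hFc hFt t).1 hL0 (hL t) (slice hFc hFt t).2
  have hparts : ∫ t in Ioo 0 T, ∫ z, kint Ω (ρ t) h z * spacePartial i u (t, z) =
      -∫ t in Ioo 0 T, ∫ z, kint Ω (ρ t) (fun x => partialE i (h x)) z * u (t, z) := by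
    rw [← integral_neg]
    refine integral_congr_ae ?_
    filter_upwards [hρ1.prod_right_ae] with t ht
    have vc := H.reg.continuous_kint hm hb ht
    have pc := (H.reg.partialE i).continuous_kint hm hb ht
    have uc := hus.continuous.comp (Continuous.prodMk_right (Y := Eu d) t)
    have ucs := (slice huc Subset.rfl t).1
    have hpe := H.reg.partialE_kint hm hb ht i
    rw [← hpe]
    refine integral_mul_fderiv_eq_neg_fderiv_mul_of_integrable ?_
      ((vc.mul (hF.comp (Continuous.prodMk_right t))).integrable_of_hasCompactSupport
        (slice hFc hFt t).1.mul_left)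
      ((vc.mul uc).integrable_of_hasCompactSupport ucs.mul_left)
      (fun z _ => H.reg.differentiable_kint hm hb ht z)
      (fun z _ => (hus.comp (contDiff_const.prodMk contDiff_id)).differentiable (by simp) z)
    change Integrable fun z => partialE i (kint Ω (ρ t) h) z * u (t, z)
    rw [hpe]
    exact (pc.mul uc).integrable_of_hasCompactSupport ucs.mul_left
  have hcs := sq_integral_mul_le hpm.integrable_sq hum.integrable_sq ipu
  have hS : ∫ p, kint Ω (ρ p.1) (fun x => partialE i (h x)) p.2 ^ 2
      ∂((volume.restrict (Ioo 0 T)).prod volume) ≤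
      2 * C * (∫ x in Ω, ρin x ^ 2) + 4 * ((d + 1) * C) * ∫ t in Ioo 0 T, ∫ x in Ω, ρ t x ^ 2 := by
    refine le_trans ?_ (H.integral_sum_sq_le hT hm hb hρ hρ2 hi hi2 hW)
    have hp2 : Integrable (fun q : ℝ × Eu d =>
        ∑ k, kint Ω (ρ q.1) (fun x => partialE k (h x)) q.2 ^ 2)
        ((volume.restrict (Ioo 0 T)).prod volume) :=
      integrable_finsetSum _ fun k _ => ((H.reg.partialE k).memLp_kint hm hb hρ hρ2).integrable_sq
    rw [← integral_prod _ hp2]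
    exact integral_mono hpm.integrable_sq hp2 fun q => Finset.single_le_sum
      (f := fun k => kint Ω (ρ q.1) (fun x => partialE k (h x)) q.2 ^ 2)
      (fun _ _ => sq_nonneg _) (Finset.mem_univ i)
  have hu2 : ∫ p, u p ^ 2 ∂((volume.restrict (Ioo 0 T)).prod (volume : Measure (Eu d))) =
      ∫ p in Ioo 0 T ×ˢ Ω, u p ^ 2 := by
    rw [← Measure.restrict_univ (μ := (volume : Measure (Eu d))), Measure.prod_restrict,
      ← Measure.volume_eq_prod]
    refine setIntegral_eq_of_subset_of_forall_sdiff_eq_zero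
      (measurableSet_Ioo.prod MeasurableSet.univ) (Set.prod_mono_right (subset_univ _)) ?_
    intro p hp
    have : p ∉ tsupport u := fun h0 => hp.2 (hut h0)
    rw [image_eq_zero_of_notMem_tsupport this]
    simp
  rw [integral_prod _ ipu, hu2] at hcs
  have hcs2 := abs_le_sqrt (hcs.trans (mul_le_mul_of_nonneg_right hS
    (integral_nonneg fun _ => sq_nonneg _)))
  rw [sqrt_mul' _ (integral_nonneg fun _ => sq_nonneg _)] at hcs2
  rw [hparts] at happ
  rw [abs_le] at happ hcs2 ⊢
  constructor <;> nlinarith [happ.1, happ.2, hcs2.1, hcs2.2]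

end EnergyKernel

theorem le_of_forall_le_add_mul {X S D : ℝ} (h : ∀ ε, 0 < ε → ε ≤ 1 → X ≤ S + D * ε) : X ≤ S := by
  have ht : Tendsto (fun ε : ℝ => S + D * ε) (𝓝[>] 0) (𝓝 (S + D * 0)) :=
    ((continuous_const.add (continuous_const.mul continuous_id)).tendsto 0).mono_left
      nhdsWithin_le_nhds
  rw [mul_zero, add_zero] at ht
  refine ge_of_tendsto ht ?_
  filter_upwards [Ioc_mem_nhdsGT (zero_lt_one (α := ℝ))] with ε hε
  exact h ε hε.1 hε.2

theorem exists_weak_partial {d : ℕ} {T : ℝ} (hT : 0 < T) {ζ : Eu d → ℝ} {Ω : Set (Eu d)}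
    (hm : MeasurableSet Ω) (hb : IsBounded Ω) {C : ℝ} (hC : 0 ≤ C)
    (hker : ∀ ε : ℝ, 0 < ε → ε ≤ 1 → ∃ r h P f A, EnergyKernel ζ Ω C ε r h P f A)
    {ρ : ℝ → Eu d → ℝ} {ρin : Eu d → ℝ}
    (hρ : Measurable (fun p : ℝ × Eu d => ρ p.1 p.2))
    (hρ2 : IntegrableOn (fun p : ℝ × Eu d => ρ p.1 p.2 ^ 2) (Ioo 0 T ×ˢ Ω))
    (hi : Measurable ρin) (hi2 : IntegrableOn (fun x => ρin x ^ 2) Ω)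
    (hW : WeakHeat T ζ Ω ρ ρin) (i : Fin d) :
    ∃ g : ℝ → Eu d → ℝ, Measurable (fun p : ℝ × Eu d => g p.1 p.2) ∧
      IntegrableOn (fun p : ℝ × Eu d => g p.1 p.2 ^ 2) (Ioo 0 T ×ˢ Ω) ∧
      (∀ u ∈ testFunctions T Ω,
        (∫ t in Ioo (0 : ℝ) T, ∫ x in Ω, ρ t x * spacePartial i u (t, x))
          = -∫ t in Ioo (0 : ℝ) T, ∫ x in Ω, g t x * u (t, x)) ∧
      (∫ t in Ioo (0 : ℝ) T, ∫ x in Ω, g t x ^ 2)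
        ≤ 2 * C * (∫ x in Ω, ρin x ^ 2) +
          4 * ((d + 1) * C) * ∫ t in Ioo 0 T, ∫ x in Ω, ρ t x ^ 2 := by
  have hprod : (volume.restrict (Ioo (0:ℝ) T)).prod (volume.restrict Ω) =
      volume.restrict (Ioo (0:ℝ) T ×ˢ Ω) := by
    rw [Measure.prod_restrict, ← Measure.volume_eq_prod]
  have hfub : ∀ F : ℝ × Eu d → ℝ, IntegrableOn F (Ioo 0 T ×ˢ Ω) →
      ∫ p in Ioo 0 T ×ˢ Ω, F p = ∫ t in Ioo 0 T, ∫ x in Ω, F (t, x) := fun F hF => by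
    rw [IntegrableOn, ← hprod] at hF
    rw [← hprod, integral_prod _ hF]
  have hρ2' : Integrable (fun p : ℝ × Eu d => ρ p.1 p.2 ^ 2)
      ((volume.restrict (Ioo 0 T)).prod (volume.restrict Ω)) := by rwa [hprod]
  have hfin : IsFiniteMeasure (volume.restrict Ω) :=
    isFiniteMeasure_restrict.2 hb.measure_lt_top.ne
  have hρ1 : Integrable (fun p : ℝ × Eu d => ρ p.1 p.2)
      ((volume.restrict (Ioo 0 T)).prod (volume.restrict Ω)) :=
    ((memLp_two_iff_integrable_sq hρ.aestronglyMeasurable).2 hρ2').integrable (by norm_num)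
  have iρF : ∀ {F : ℝ × Eu d → ℝ}, Continuous F → HasCompactSupport F →
      Integrable (fun p : ℝ × Eu d => ρ p.1 p.2 * F p)
      ((volume.restrict (Ioo 0 T)).prod (volume.restrict Ω)) := by
    intro F hF hFc
    obtain ⟨B, hB⟩ := hFc.exists_bound_of_continuous hF
    exact hρ1.mul_bdd (c := B) hF.aestronglyMeasurable (Eventually.of_forall hB)
  have iρu : ∀ u ∈ testFunctions T Ω, Integrable (fun p : ℝ × Eu d => ρ p.1 p.2 *
      spacePartial i u p) ((volume.restrict (Ioo 0 T)).prod (volume.restrict Ω)) :=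
    fun u hu => iρF (contDiff_spacePartial i hu.1).continuous
      (hu.2.1.of_isClosed_subset (isClosed_tsupport _) (tsupport_spacePartial i hu.1))
  have hmem : ∀ u ∈ testFunctions T Ω, MemLp u 2 (volume.restrict (Ioo (0:ℝ) T ×ˢ Ω)) :=
    fun u hu => (hu.1.continuous.memLp_of_hasCompactSupport hu.2.1).mono_measure
      Measure.restrict_le_self
  let ι : testFunctions T Ω →ₗ[ℝ] Lp ℝ 2 (volume.restrict (Ioo (0:ℝ) T ×ˢ Ω)) :=
    { toFun := fun u => (hmem u u.2).toLp u
      map_add' := fun u v => rfl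
      map_smul' := fun c u => rfl }
  let l : testFunctions T Ω →ₗ[ℝ] ℝ :=
    { toFun := fun u => -∫ p, ρ p.1 p.2 * spacePartial i (u : ℝ × Eu d → ℝ) p
        ∂((volume.restrict (Ioo 0 T)).prod (volume.restrict Ω))
      map_add' := fun u v => by
        rw [← neg_add, ← integral_add (iρu u u.2) (iρu v v.2)]
        congr 2
        ext p
        rw [Submodule.coe_add, spacePartial_add i u.2.1 v.2.1, Pi.add_apply]
        ring
      map_smul' := fun c u => by
        rw [RingHom.id_apply, smul_eq_mul, ← neg_mul_comm, neg_mul, ← integral_const_mul]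
        congr 2
        ext p
        rw [Submodule.coe_smul, spacePartial_smul i u.2.1, Pi.smul_apply, smul_eq_mul]
        ring }
  have hN : 0 ≤ 2 * C * (∫ x in Ω, ρin x ^ 2) +
      4 * ((d + 1) * C) * ∫ t in Ioo 0 T, ∫ x in Ω, ρ t x ^ 2 := by
    have h1 : 0 ≤ ∫ x in Ω, ρin x ^ 2 := integral_nonneg fun _ => sq_nonneg _
    have h2 : 0 ≤ ∫ t in Ioo 0 T, ∫ x in Ω, ρ t x ^ 2 :=
      integral_nonneg fun _ => integral_nonneg fun _ => sq_nonneg _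
    positivity
  have hnorm : ∀ G : Lp ℝ 2 (volume.restrict (Ioo (0:ℝ) T ×ˢ Ω)),
      ‖G‖ ^ 2 = ∫ p in Ioo (0:ℝ) T ×ˢ Ω, G p ^ 2 := by
    intro G
    rw [← real_inner_self_eq_norm_sq, L2.inner_def]
    simp [pow_two]
  obtain ⟨G, hGn, hG⟩ := exists_inner_eq_of_bounded ι l
    (sqrt_nonneg (2 * C * (∫ x in Ω, ρin x ^ 2) +
      4 * ((d + 1) * C) * ∫ t in Ioo 0 T, ∫ x in Ω, ρ t x ^ 2)) (fun u => by
    obtain ⟨L, hL0, hL⟩ := exists_lipschitz_spacePartial i u.2.1 u.2.2.1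
    refine le_of_forall_le_add_mul (D := C * L * ∫ t in Ioo 0 T, ∫ x in Ω, |ρ t x|)
      fun ε hε hε1 => ?_
    obtain ⟨r, h, P, f, A, H⟩ := hker ε hε hε1
    have key := H.abs_integral_spacePartial_le hT hm hb hρ hρ2' hi hi2 hW i u.2 hL0 hL
    have hnu : ‖ι u‖ = √(∫ p in Ioo 0 T ×ˢ Ω, (u : ℝ × Eu d → ℝ) p ^ 2) := by
      rw [← sqrt_sq (norm_nonneg (ι u)), hnorm]
      congr 1
      refine integral_congr_ae ?_
      filter_upwards [(hmem u u.2).coeFn_toLp] with p hp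
      change ((hmem u u.2).toLp u : ℝ × Eu d → ℝ) p ^ 2 = _
      rw [hp]
    have hlu : l u = -∫ t in Ioo 0 T, ∫ x in Ω, ρ t x * spacePartial i u (t, x) := by
      change -_ = -_
      rw [integral_prod _ (iρu u u.2)]
    rw [hnu, hlu, abs_neg]
    exact key)
  have hGm : Measurable (G : ℝ × Eu d → ℝ) := (Lp.stronglyMeasurable G).measurable
  have hG2 : IntegrableOn (fun p : ℝ × Eu d => G p ^ 2) (Ioo 0 T ×ˢ Ω) := (Lp.memLp G).integrable_sq
  refine ⟨fun t x => G (t, x), hGm, hG2, fun u hu => ?_, ?_⟩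
  · have h1 := hG ⟨u, hu⟩
    change -_ = _ at h1
    have h2 : ⟪G, ι ⟨u, hu⟩⟫ = ∫ p in Ioo (0:ℝ) T ×ˢ Ω, G p * u p := by
      rw [L2.inner_def]
      refine integral_congr_ae ?_
      filter_upwards [(hmem u hu).coeFn_toLp] with p hp
      change ⟪G p, ((hmem u hu).toLp u : ℝ × Eu d → ℝ) p⟫ = _
      rw [hp]
      simp [mul_comm]
    rw [h2, hfub (fun p => G p * u p) ((Lp.memLp G).integrable_mul (hmem u hu)),
      integral_prod _ (iρu u hu)] at h1
    linarith
  · have h3 : ∫ t in Ioo (0 : ℝ) T, ∫ x in Ω, G (t, x) ^ 2 = ‖G‖ ^ 2 := by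
      rw [hnorm, hfub _ hG2]
    rw [h3, ← sq_sqrt hN]
    exact pow_le_pow_left₀ (norm_nonneg _) hGn 2

theorem exists_weak_gradient_of_energyKernels (d : ℕ) (T : ℝ) (hT : 0 < T)
    (ζ : Eu d → ℝ)
    (Ω : Set (Eu d)) (hm : MeasurableSet Ω) (hΩbdd : IsBounded Ω)
    (hker : ∃ C : ℝ, 0 ≤ C ∧ ∀ ε : ℝ, 0 < ε → ε ≤ 1 → ∃ r h P f A, EnergyKernel ζ Ω C ε r h P f A) :
    ∃ C : ℝ → ℝ → ℝ,
      ∀ (ρ : ℝ → Eu d → ℝ) (ρin : Eu d → ℝ),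
        Measurable (fun p : ℝ × Eu d => ρ p.1 p.2) →
        IntegrableOn (fun p : ℝ × Eu d => (ρ p.1 p.2) ^ 2) (Ioo 0 T ×ˢ Ω) →
        Measurable ρin →
        IntegrableOn (fun x => (ρin x) ^ 2) Ω →
        -- weak formulation of the Neumann heat equation
        (∀ ψ : ℝ → Eu d → ℝ,
          ContDiff ℝ (⊤ : ℕ∞) (fun p : ℝ × Eu d => ψ p.1 p.2) →
          (∀ x, ψ T x = 0) →
          (∀ t ∈ Ioo (0 : ℝ) T, ∀ x ∈ frontier Ω,
            fderiv ℝ (fun y => ψ t y) x (unitNormal ζ x) = 0) →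
          (∫ t in Ioo (0 : ℝ) T, ∫ x in Ω,
              ρ t x * (deriv (fun s => ψ s x) t + lapE (fun y => ψ t y) x))
            + (∫ x in Ω, ρin x * ψ 0 x) = 0) →
        ∀ i : Fin d, ∃ g : ℝ → Eu d → ℝ,
          Measurable (fun p : ℝ × Eu d => g p.1 p.2) ∧
          IntegrableOn (fun p : ℝ × Eu d => (g p.1 p.2) ^ 2) (Ioo 0 T ×ˢ Ω) ∧
          -- g represents the distributional derivative ∂ρ/∂x_i
          (∀ u : ℝ → Eu d → ℝ,
            ContDiff ℝ (⊤ : ℕ∞) (fun p : ℝ × Eu d => u p.1 p.2) →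
            HasCompactSupport (fun p : ℝ × Eu d => u p.1 p.2) →
            tsupport (fun p : ℝ × Eu d => u p.1 p.2) ⊆ Ioo 0 T ×ˢ Ω →
            (∫ t in Ioo (0 : ℝ) T, ∫ x in Ω, ρ t x * fderiv ℝ (fun y => u t y) x (basisE d i))
              = -∫ t in Ioo (0 : ℝ) T, ∫ x in Ω, g t x * u t x) ∧
          -- L² bound depending only on the L² norms of ρin and ρ
          (∫ t in Ioo (0 : ℝ) T, ∫ x in Ω, (g t x) ^ 2)
            ≤ C (∫ x in Ω, (ρin x) ^ 2) (∫ t in Ioo (0 : ℝ) T, ∫ x in Ω, (ρ t x) ^ 2) := by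
  obtain ⟨C, hC, hker⟩ := hker
  refine ⟨fun a b => 2 * C * a + 4 * ((d + 1) * C) * b, fun ρ ρin hρ hρ2 hi hi2 hW i => ?_⟩
  obtain ⟨g, hg, hg2, hgu, hgC⟩ := exists_weak_partial hT hm hΩbdd hC hker hρ hρ2 hi hi2 hW i
  exact ⟨g, hg, hg2, fun u hu hc ht => hgu (fun p => u p.1 p.2) ⟨hu, hc, ht⟩, hgC⟩

theorem ContDiff.partialE {d : ℕ} {f : Eu d → ℝ} (hf : ContDiff ℝ (⊤ : ℕ∞) f) (i : Fin d) :
    ContDiff ℝ (⊤ : ℕ∞) (partialE i f) :=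
  (hf.fderiv_right (by simp)).clm_apply contDiff_const

/-- A smooth mollifier at scale `ε`, with size controlled by `M`. -/
structure Mollifier {d : ℕ} (M ε : ℝ) (η : Eu d → ℝ) : Prop where
  smooth : ContDiff ℝ (⊤ : ℕ∞) η
  nonneg : ∀ y, 0 ≤ η y
  integral_eq : ∫ y, η y = 1
  supp : ∀ y, ε < ‖y‖ → η y = 0
  bound : ∀ y, |η y| ≤ M * (ε ^ d)⁻¹
  bound_partial : ∀ k y, |partialE k η y| ≤ M * (ε ^ d)⁻¹ * ε⁻¹

theorem Mollifier.partialE_supp {d : ℕ} {M ε : ℝ} {η : Eu d → ℝ} (hη : Mollifier M ε η) (k : Fin d)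
    {y : Eu d} (hy : ε < ‖y‖) : partialE k η y = 0 := by
  have : η =ᶠ[𝓝 y] fun _ => 0 := by
    filter_upwards [(isOpen_lt continuous_const continuous_norm).mem_nhds hy] with x hx
    exact hη.supp x hx
  rw [partialE, this.fderiv_eq]; simp

theorem partialE_comp_smul {d : ℕ} {f : Eu d → ℝ} (hf : ContDiff ℝ (⊤ : ℕ∞) f) (c : ℝ) (k : Fin d)
    (y : Eu d) : partialE k (fun y => f (c • y)) y = c * partialE k f (c • y) := by
  have h1 : HasFDerivAt f (fderiv ℝ f (c • y)) (c • y) :=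
    (hf.differentiable (by simp) _).hasFDerivAt
  have h2 := h1.comp y ((hasFDerivAt_id (𝕜 := ℝ) y).const_smul c)
  have h3 : fderiv ℝ (fun y => f (c • y)) y = _ := h2.fderiv
  rw [partialE, h3, partialE]
  simp

theorem exists_mollifier (d : ℕ) : ∃ M : ℝ, 0 ≤ M ∧ ∀ ε : ℝ, 0 < ε →
    ∃ η : Eu d → ℝ, Mollifier M ε η := by
  let φ : ContDiffBump (0 : Eu d) := ⟨1 / 2, 1, by norm_num, by norm_num⟩
  let n : Eu d → ℝ := φ.normed volume
  have hn : ContDiff ℝ (⊤ : ℕ∞) n := φ.contDiff_normed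
  have hnc : HasCompactSupport n := φ.hasCompactSupport_normed
  obtain ⟨M0, hM0⟩ := hnc.exists_bound_of_continuous hn.continuous
  have hpart : ∀ k : Fin d, ∃ M, ∀ y, ‖partialE k n y‖ ≤ M := fun k => by
    refine HasCompactSupport.exists_bound_of_continuous ?_ (hn.partialE k).continuous
    exact (hnc.fderiv ℝ).comp_left (g := fun l : Eu d →L[ℝ] ℝ => l (basisE d k)) (by simp)
  choose M1 hM1 using hpart
  have hM1' : ∀ k, 0 ≤ M1 k := fun k => (norm_nonneg _).trans (hM1 k 0)
  have hM0' : 0 ≤ M0 := (norm_nonneg _).trans (hM0 0)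
  have hM2 : ∀ k y, ‖partialE k n y‖ ≤ ∑ k, M1 k := fun k y =>
    (hM1 k y).trans (Finset.single_le_sum (fun k _ => hM1' k) (Finset.mem_univ k))
  have hM3 : 0 ≤ ∑ k, M1 k := Finset.sum_nonneg fun k _ => hM1' k
  refine ⟨M0 + ∑ k, M1 k, by positivity, fun ε hε => ⟨fun y => (ε ^ d)⁻¹ * n (ε⁻¹ • y), ?_⟩⟩
  have hsm : ContDiff ℝ (⊤ : ℕ∞) (fun y : Eu d => n (ε⁻¹ • y)) :=
    hn.comp (contDiff_const_smul ε⁻¹)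
  have hpos : 0 ≤ (ε ^ d)⁻¹ := by positivity
  refine ⟨contDiff_const.mul hsm, fun y => mul_nonneg hpos (φ.nonneg_normed _), ?_, fun y hy => ?_,
    fun y => ?_, fun k y => ?_⟩
  · rw [integral_const_mul, Measure.integral_comp_smul, φ.integral_normed]
    simp only [finrank_euclideanSpace, Fintype.card_fin, smul_eq_mul, mul_one, inv_pow, inv_inv]
    rw [abs_of_nonneg (by positivity), inv_mul_cancel₀ (by positivity)]
  · have : ε⁻¹ • y ∉ Function.support n := by
      rw [φ.support_normed_eq]
      simp only [Metric.mem_ball, dist_zero_right, norm_smul, norm_inv, Real.norm_eq_abs,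
        abs_of_pos hε, not_lt]
      change 1 ≤ _
      rw [inv_mul_eq_div, le_div_iff₀ hε]
      linarith
    rw [Function.notMem_support.1 this, mul_zero]
  · rw [abs_mul, abs_of_nonneg hpos, mul_comm]
    exact mul_le_mul_of_nonneg_right ((hM0 _).trans (by linarith)) hpos
  · have : partialE k (fun y => (ε ^ d)⁻¹ * n (ε⁻¹ • y)) y
        = (ε ^ d)⁻¹ * (ε⁻¹ * partialE k n (ε⁻¹ • y)) := by
      rw [← partialE_comp_smul hn, partialE, fderiv_const_mul (hsm.differentiable (by simp) y)]
      rfl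
    rw [this, abs_mul, abs_mul, abs_of_nonneg hpos, abs_of_nonneg (inv_nonneg.2 hε.le)]
    have h4 : |partialE k n (ε⁻¹ • y)| ≤ M0 + ∑ k, M1 k := (hM2 _ _).trans (by linarith)
    calc (ε ^ d)⁻¹ * (ε⁻¹ * |partialE k n (ε⁻¹ • y)|)
        = |partialE k n (ε⁻¹ • y)| * ((ε ^ d)⁻¹ * ε⁻¹) := by ring
      _ ≤ (M0 + ∑ k, M1 k) * ((ε ^ d)⁻¹ * ε⁻¹) :=
          mul_le_mul_of_nonneg_right h4 (by positivity)
      _ = _ := by ring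

theorem setIntegral_abs_le_of_supp {d : ℕ} {s : Set (Eu d)} (hs : MeasurableSet s)
    {φ : Eu d → ℝ} {B ρ : ℝ} {x₀ : Eu d} (hB : 0 ≤ B) (hρ : 0 ≤ ρ) (hbd : ∀ x ∈ s, |φ x| ≤ B)
    (hsupp : ∀ x ∈ s, φ x ≠ 0 → ‖x - x₀‖ ≤ ρ) :
    ∫ x in s, |φ x| ≤ B * (ρ ^ d * volume.real (Metric.ball (0 : Eu d) 1)) := by
  have hi : Integrable ((Metric.closedBall x₀ ρ).indicator fun _ => B) := by
    rw [integrable_indicator_iff Metric.isClosed_closedBall.measurableSet]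
    exact integrableOn_const measure_closedBall_lt_top.ne
  have h1 : ∫ x in s, |φ x| ≤ ∫ x in s, (Metric.closedBall x₀ ρ).indicator (fun _ => B) x := by
    refine integral_mono_of_nonneg (Eventually.of_forall fun _ => abs_nonneg _)
      hi.integrableOn ?_
    filter_upwards [ae_restrict_mem hs] with x hx
    by_cases h0 : φ x = 0
    · rw [h0, abs_zero]
      exact indicator_nonneg (fun _ _ => hB) x
    · rw [indicator_of_mem (by simpa [dist_eq_norm] using hsupp x hx h0)]
      exact hbd x hx
  have h2 : ∫ x in s, (Metric.closedBall x₀ ρ).indicator (fun _ => B) x ≤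
      ∫ x, (Metric.closedBall x₀ ρ).indicator (fun _ => B) x :=
    setIntegral_le_integral hi (Eventually.of_forall fun _ => indicator_nonneg (fun _ _ => hB) _)
  refine (h1.trans h2).trans_eq ?_
  rw [integral_indicator Metric.isClosed_closedBall.measurableSet, setIntegral_const,
    Measure.addHaar_real_closedBall _ _ hρ]
  simp [mul_comm]

theorem schurBound_of_supp {d : ℕ} {Ω S : Set (Eu d)} (hm : MeasurableSet Ω) (hb : IsBounded Ω)
    {r c M ε : ℝ} (hc0 : 0 ≤ c) (hM : 0 ≤ M) (hε : 0 < ε) {R : Eu d → Eu d}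
    {K : Eu d → Eu d → ℝ} (hK : Continuous (fun p : Eu d × Eu d => K p.1 p.2))
    (hs : ∀ x ∈ Ω, ∀ z, r < ‖z‖ → K x z = 0)
    (hbd : ∀ x ∈ Ω, ∀ z, |K x z| ≤ M * (ε ^ d)⁻¹)
    (hsupp : ∀ x ∈ Ω, ∀ z, K x z ≠ 0 → x ∈ S ∧ ‖R x - z‖ ≤ ε)
    (hR : ∀ x ∈ Ω ∩ S, ∀ y ∈ Ω ∩ S, ‖x - y‖ ≤ c * ‖R x - R y‖) :
    SchurBound Ω (M ^ 2 * volume.real (Metric.ball (0 : Eu d) 1) ^ 2 * (2 * c) ^ d) K := by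
  intro w hw hw2
  have hω : 0 ≤ volume.real (Metric.ball (0 : Eu d) 1) := measureReal_nonneg
  have hB : 0 ≤ M * (ε ^ d)⁻¹ := by positivity
  have hcx : ∀ z, Continuous fun x => K x z := fun z =>
    hK.comp (by fun_prop : Continuous fun x : Eu d => (x, z))
  have hx : ∀ z, ∫ x in Ω, |K x z| ≤ M * (2 * c) ^ d * volume.real (Metric.ball (0 : Eu d) 1) := by
    intro z
    by_cases hz : ∃ x₀ ∈ Ω, K x₀ z ≠ 0
    · obtain ⟨x₀, hx₀, hk₀⟩ := hz
      refine (setIntegral_abs_le_of_supp hm hB (ρ := c * (2 * ε)) (x₀ := x₀) (by positivity)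
        (fun x hx => hbd x hx z) fun x hx hk => ?_).trans_eq ?_
      · obtain ⟨h1, h2⟩ := hsupp x hx z hk
        obtain ⟨h3, h4⟩ := hsupp x₀ hx₀ z hk₀
        refine (hR x ⟨hx, h1⟩ x₀ ⟨hx₀, h3⟩).trans (mul_le_mul_of_nonneg_left ?_ hc0)
        have := norm_sub_le (R x - z) (R x₀ - z)
        rw [sub_sub_sub_cancel_right] at this
        linarith
      · have : ε ^ d ≠ 0 := by positivity
        rw [show c * (2 * ε) = (2 * c) * ε by ring, mul_pow]
        field_simp
    · push Not at hz
      rw [setIntegral_congr_fun hm (g := fun _ => (0 : ℝ)) fun x hx => by simp [hz x hx]]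
      simp only [integral_zero]
      positivity
  have hz : ∀ x ∈ Ω, ∫ z, |K x z| ≤ M * volume.real (Metric.ball (0 : Eu d) 1) := by
    intro x hx
    have := setIntegral_abs_le_of_supp (d := d) MeasurableSet.univ hB (φ := K x) (ρ := ε)
      (x₀ := R x) hε.le (fun z _ => hbd x hx z) fun z _ hk => by
        rw [norm_sub_rev]; exact (hsupp x hx z hk).2
    rw [setIntegral_univ] at this
    refine this.trans_eq ?_
    have : ε ^ d ≠ 0 := by positivity
    field_simp
  have hjoint : Integrable (fun p : Eu d × Eu d => w p.2 ^ 2 * |K p.2 p.1|)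
      (volume.prod (volume.restrict Ω)) := by
    have h1 : Integrable ((Metric.closedBall (0 : Eu d) r).indicator fun _ => M * (ε ^ d)⁻¹) := by
      rw [integrable_indicator_iff Metric.isClosed_closedBall.measurableSet]
      exact integrableOn_const measure_closedBall_lt_top.ne
    refine (h1.mul_prod hw2).mono' ?_ ?_
    · exact ((hw.comp measurable_snd).pow_const 2).aestronglyMeasurable.mul (hK.comp
        (by fun_prop : Continuous fun p : Eu d × Eu d => (p.2, p.1))).abs.aestronglyMeasurable
    · have hae := Measure.quasiMeasurePreserving_snd (μ := (volume : Measure (Eu d)))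
        (ν := (volume.restrict Ω)) |>.ae (ae_restrict_mem hm)
      filter_upwards [hae] with p hp
      rw [norm_of_nonneg (by positivity), mul_comm]
      refine mul_le_mul_of_nonneg_right ?_ (sq_nonneg _)
      by_cases hpr : r < ‖p.1‖
      · rw [hs _ hp _ hpr, abs_zero]
        exact indicator_nonneg (fun _ _ => hB) _
      · rw [indicator_of_mem (by simpa using hpr)]
        exact hbd _ hp _
  have hpt : ∀ᵐ z, kint Ω w K z ^ 2 ≤ (∫ x in Ω, w x ^ 2 * |K x z|) *
      (M * (2 * c) ^ d * volume.real (Metric.ball (0 : Eu d) 1)) := by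
    filter_upwards [hjoint.prod_right_ae] with z hz
    have hfin : IsFiniteMeasure (volume.restrict Ω) :=
      isFiniteMeasure_restrict.2 hb.measure_lt_top.ne
    have hKi : Integrable (fun x => |K x z|) (volume.restrict Ω) := by
      refine (integrable_const (M * (ε ^ d)⁻¹)).mono' (hcx z).abs.aestronglyMeasurable ?_
      filter_upwards [ae_restrict_mem hm] with x hx
      rw [Real.norm_eq_abs, abs_abs]
      exact hbd x hx z
    have e1 : ∀ x, (|w x| * √|K x z|) ^ 2 = w x ^ 2 * |K x z| := fun x => by
      rw [mul_pow, sq_abs, sq_sqrt (abs_nonneg _)]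
    have e2 : ∀ x, √|K x z| ^ 2 = |K x z| := fun x => sq_sqrt (abs_nonneg _)
    have e3 : ∀ x, |w x| * √|K x z| * √|K x z| = |w x * K x z| := fun x => by
      rw [mul_assoc, mul_self_sqrt (abs_nonneg _), abs_mul]
    have hcs := sq_integral_mul_le (μ := volume.restrict Ω) (f := fun x => |w x| * √|K x z|)
      (g := fun x => √|K x z|) (by simpa only [e1] using hz) (by simpa only [e2] using hKi) (by
        simp only [e3]
        exact (integrableOn_mul_kernel hm hb hK hs (integrableOn_of_sq hb hw hw2) z).abs)
    simp only [e1, e2, e3] at hcs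
    have h1 : kint Ω w K z ^ 2 ≤ (∫ x in Ω, |w x * K x z|) ^ 2 := by
      rw [← sq_abs (kint Ω w K z)]
      exact pow_le_pow_left₀ (abs_nonneg _) (abs_integral_le_integral_abs) 2
    exact h1.trans (hcs.trans (mul_le_mul_of_nonneg_left (hx z)
      (integral_nonneg fun _ => by positivity)))
  have h1 := integral_mono_of_nonneg (Eventually.of_forall fun z => sq_nonneg (kint Ω w K z))
    (hjoint.integral_prod_left.mul_const _) hpt
  refine h1.trans ?_
  rw [integral_mul_const, integral_integral_swap (f := fun z x => w x ^ 2 * |K x z|) hjoint]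
  have h2 : ∫ x in Ω, ∫ z, w x ^ 2 * |K x z| ≤
      ∫ x in Ω, w x ^ 2 * (M * volume.real (Metric.ball (0 : Eu d) 1)) := by
    refine integral_mono_ae hjoint.integral_prod_right (hw2.mul_const _) ?_
    filter_upwards [ae_restrict_mem hm] with x hx
    rw [integral_const_mul]
    exact mul_le_mul_of_nonneg_left (hz x hx) (sq_nonneg _)
  rw [integral_mul_const] at h2
  calc _ ≤ ((∫ x in Ω, w x ^ 2) * (M * volume.real (Metric.ball (0 : Eu d) 1))) *
        (M * (2 * c) ^ d * volume.real (Metric.ball (0 : Eu d) 1)) :=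
        mul_le_mul_of_nonneg_right h2 (by positivity)
    _ = _ := by ring

section PartialDerivatives

variable {d : ℕ} {f g : Eu d → ℝ} {x : Eu d}

theorem partialE_add (i : Fin d) (hf : DifferentiableAt ℝ f x) (hg : DifferentiableAt ℝ g x) :
    partialE i (fun y => f y + g y) x = partialE i f x + partialE i g x := by
  rw [partialE, fderiv_fun_add hf hg]; rfl

theorem partialE_neg (i : Fin d) : partialE i (fun y => -f y) x = -partialE i f x := by
  rw [partialE, fderiv_fun_neg]; rfl

theorem partialE_mul (i : Fin d) (hf : DifferentiableAt ℝ f x) (hg : DifferentiableAt ℝ g x) :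
    partialE i (fun y => f y * g y) x = partialE i f x * g x + f x * partialE i g x := by
  rw [partialE, fderiv_fun_mul hf hg]
  simp [partialE]
  ring

theorem partialE_const_mul (i : Fin d) (c : ℝ) (hf : DifferentiableAt ℝ f x) :
    partialE i (fun y => c * f y) x = c * partialE i f x := by
  rw [partialE, fderiv_const_mul hf]; rfl

theorem partialE_sum (i : Fin d) {ι : Type*} {s : Finset ι} {F : ι → Eu d → ℝ}
    (hF : ∀ k ∈ s, DifferentiableAt ℝ (F k) x) :
    partialE i (fun y => ∑ k ∈ s, F k y) x = ∑ k ∈ s, partialE i (F k) x := by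
  rw [partialE, fderiv_fun_sum hF]
  simp [partialE]

theorem clm_apply_eq_sum (φ : Eu d →L[ℝ] ℝ) (v : Eu d) : φ v = ∑ l, v l * φ (basisE d l) := by
  have h : v = ∑ l, v l • basisE d l := by
    ext j
    simp [basisE, Pi.single_apply]
  conv_lhs => rw [h]
  simp [map_sum]

theorem fderiv_apply_coord {R : Eu d → Eu d} (hR : DifferentiableAt ℝ R x) (v : Eu d) (l : Fin d) :
    fderiv ℝ R x v l = fderiv ℝ (fun y => R y l) x v := by
  have h1 : HasFDerivAt R (fderiv ℝ R x) x := hR.hasFDerivAt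
  have h2 := ((EuclideanSpace.proj l : Eu d →L[ℝ] ℝ).hasFDerivAt).comp x h1
  have h3 : fderiv ℝ (fun y => R y l) x = _ := h2.fderiv
  rw [h3]; rfl

theorem partialE_comp_sub {R : Eu d → Eu d} (hR : DifferentiableAt ℝ R x) (z : Eu d)
    (hg : DifferentiableAt ℝ g (R x - z)) (i : Fin d) :
    partialE i (fun y => g (R y - z)) x =
      ∑ l, partialE i (fun y => R y l) x * partialE l g (R x - z) := by
  have h2 := hg.hasFDerivAt.comp x (hR.hasFDerivAt.sub_const z)
  have h3 : fderiv ℝ (fun y => g (R y - z)) x = _ := h2.fderiv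
  rw [partialE, h3, ContinuousLinearMap.comp_apply, clm_apply_eq_sum]
  refine Finset.sum_congr rfl fun l _ => ?_
  rw [fderiv_apply_coord hR]; rfl

theorem partialE_const_sub {y : Eu d} (hg : DifferentiableAt ℝ g (y - x)) (i : Fin d) :
    partialE i (fun z => g (y - z)) x = -partialE i g (y - x) := by
  have h2 := hg.hasFDerivAt.comp x ((hasFDerivAt_id (𝕜 := ℝ) x).const_sub y)
  have h3 : fderiv ℝ (fun z => g (y - z)) x = _ := h2.fderiv
  rw [partialE, h3]
  simp [partialE]

theorem partialE_eq_zero_of_notMem_tsupport (hx : x ∉ tsupport f) (i : Fin d) :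
    partialE i f x = 0 := by
  have : fderiv ℝ f x = 0 := by
    by_contra h0
    exact hx (support_fderiv_subset ℝ h0)
  rw [partialE, this]; rfl

theorem tsupport_partialE (f : Eu d → ℝ) (i : Fin d) : tsupport (partialE i f) ⊆ tsupport f :=
  closure_minimal (fun _ h => by_contra fun hx => h (partialE_eq_zero_of_notMem_tsupport hx i))
    (isClosed_tsupport f)

end PartialDerivatives

/-- The metric `∑ᵢ ∂ᵢRₖ ∂ᵢRₗ` of a map `R`. -/
def pushMetric {d : ℕ} (R : Eu d → Eu d) (k l : Fin d) (x : Eu d) : ℝ :=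
  ∑ i, partialE i (fun y => R y k) x * partialE i (fun y => R y l) x

/-- The first order coefficient of the Laplacian of `χ(x) η(R x - z)`. -/
def branchDrift {d : ℕ} (R : Eu d → Eu d) (χ : Eu d → ℝ) (k : Fin d) (x : Eu d) : ℝ :=
  ∑ i, (partialE i χ x * partialE i (fun y => R y k) x +
    partialE i (fun y => χ y * partialE i (fun y => R y k) y) x)

/-- The kernel `χ(x) η(R x - z)`. -/
def branchKernel {d : ℕ} (R : Eu d → Eu d) (χ η : Eu d → ℝ) (x z : Eu d) : ℝ := χ x * η (R x - z)

/-- The flux whose divergence in `z` is the leading part of `Δₓ (χ(x) η(R x - z))`. -/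
def branchFlux {d : ℕ} (R : Eu d → Eu d) (χ η : Eu d → ℝ) (l : Fin d) (x z : Eu d) : ℝ :=
  -(∑ k, χ x * pushMetric R l k x * partialE k η (R x - z) + branchDrift R χ l x * η (R x - z))

/-- The zero order part of `Δₓ (χ(x) η(R x - z))`. -/
def branchZero {d : ℕ} (R : Eu d → Eu d) (χ η : Eu d → ℝ) (x z : Eu d) : ℝ :=
  lapE χ x * η (R x - z)

/-- A smooth branch `R` with cutoff `χ`, compatible with the coefficient field `A`. -/
structure Branch {d : ℕ} (Ω : Set (Eu d)) (A : Fin d → Fin d → Eu d → ℝ) (c L : ℝ)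
    (R : Eu d → Eu d) (χ : Eu d → ℝ) : Prop where
  smooth_map : ContDiff ℝ (⊤ : ℕ∞) R
  smooth_cutoff : ContDiff ℝ (⊤ : ℕ∞) χ
  antilipschitz : ∀ x ∈ Ω ∩ tsupport χ, ∀ y ∈ Ω ∩ tsupport χ, ‖x - y‖ ≤ c * ‖R x - R y‖
  near : ∀ x ∈ Ω ∩ tsupport χ, ∀ k l z, |A k l z - pushMetric R k l x| ≤ L * ‖R x - z‖

section Branch

variable {d : ℕ} {Ω : Set (Eu d)} {A : Fin d → Fin d → Eu d → ℝ} {c L M ε r : ℝ}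
  {R : Eu d → Eu d} {χ η : Eu d → ℝ}

theorem contDiff_coord (hR : ContDiff ℝ (⊤ : ℕ∞) R) (k : Fin d) :
    ContDiff ℝ (⊤ : ℕ∞) (fun y => R y k) :=
  (EuclideanSpace.proj k : Eu d →L[ℝ] ℝ).contDiff.comp hR

theorem contDiff_pushMetric (hR : ContDiff ℝ (⊤ : ℕ∞) R) (k l : Fin d) :
    ContDiff ℝ (⊤ : ℕ∞) (pushMetric R k l) :=
  ContDiff.sum fun i _ =>
    ((contDiff_coord hR k).partialE i).mul ((contDiff_coord hR l).partialE i)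

theorem contDiff_branchDrift (hR : ContDiff ℝ (⊤ : ℕ∞) R) (hχ : ContDiff ℝ (⊤ : ℕ∞) χ)
    (k : Fin d) : ContDiff ℝ (⊤ : ℕ∞) (branchDrift R χ k) :=
  ContDiff.sum fun i _ => ((hχ.partialE i).mul ((contDiff_coord hR k).partialE i)).add
    ((hχ.mul ((contDiff_coord hR k).partialE i)).partialE i)

theorem contDiff_lapE (hχ : ContDiff ℝ (⊤ : ℕ∞) χ) : ContDiff ℝ (⊤ : ℕ∞) (lapE χ) :=
  ContDiff.sum fun i _ => (hχ.partialE i).partialE i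

theorem branchDrift_eq_zero {x : Eu d} (hx : x ∉ tsupport χ) (k : Fin d) :
    branchDrift R χ k x = 0 := by
  refine Finset.sum_eq_zero fun i _ => ?_
  rw [partialE_eq_zero_of_notMem_tsupport hx, partialE_eq_zero_of_notMem_tsupport
    (fun h => hx (tsupport_mul_subset_left h))]
  simp

theorem lapE_eq_zero {x : Eu d} (hx : x ∉ tsupport χ) : lapE χ x = 0 :=
  Finset.sum_eq_zero fun i _ =>
    partialE_eq_zero_of_notMem_tsupport (fun h => hx (tsupport_partialE χ i h)) i

theorem lapE_branchKernel (hR : ContDiff ℝ (⊤ : ℕ∞) R) (hχ : ContDiff ℝ (⊤ : ℕ∞) χ)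
    (hη : ContDiff ℝ (⊤ : ℕ∞) η) (x z : Eu d) :
    lapE (fun y => branchKernel R χ η y z) x =
      ∑ l, partialE l (branchFlux R χ η l x) z + branchZero R χ η x z := by
  have dR : ∀ y, DifferentiableAt ℝ R y := hR.differentiable (by simp)
  have dη : ∀ y, DifferentiableAt ℝ η y := hη.differentiable (by simp)
  have dχ : ∀ y, DifferentiableAt ℝ χ y := hχ.differentiable (by simp)
  have dηR : ∀ y, DifferentiableAt ℝ (fun y => η (R y - z)) y := fun y =>
    (dη _).comp y ((dR y).sub_const z)
  have dη1 : ∀ k y, DifferentiableAt ℝ (partialE k η) y := fun k =>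
    (hη.partialE k).differentiable (by simp)
  have dηR1 : ∀ k y, DifferentiableAt ℝ (fun y => partialE k η (R y - z)) y := fun k y =>
    (dη1 k _).comp y ((dR y).sub_const z)
  have dχ1 : ∀ k y, DifferentiableAt ℝ (partialE k χ) y := fun k =>
    (hχ.partialE k).differentiable (by simp)
  have dR1 : ∀ k i y, DifferentiableAt ℝ (partialE i (fun y => R y k)) y := fun k i =>
    ((contDiff_coord hR k).partialE i).differentiable (by simp)
  have h1 : ∀ i y, partialE i (fun y => branchKernel R χ η y z) y =
      partialE i χ y * η (R y - z) +
        ∑ k, χ y * partialE i (fun y => R y k) y * partialE k η (R y - z) := by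
    intro i y
    unfold branchKernel
    rw [partialE_mul i (dχ y) (dηR y), partialE_comp_sub (dR y) z (dη _), Finset.mul_sum]
    simp_rw [mul_assoc]
  have h2 : ∀ i, partialE i (partialE i (fun y => branchKernel R χ η y z)) x =
      partialE i (partialE i χ) x * η (R x - z) +
      ∑ k, ((partialE i χ x * partialE i (fun y => R y k) x +
        partialE i (fun y => χ y * partialE i (fun y => R y k) y) x) * partialE k η (R x - z) +
        ∑ l, χ x * (partialE i (fun y => R y l) x * partialE i (fun y => R y k) x) *
          partialE l (partialE k η) (R x - z)) := by
    intro i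
    have d1 : DifferentiableAt ℝ (fun y => partialE i χ y * η (R y - z)) x :=
      (dχ1 i x).mul (dηR x)
    have d2 : ∀ k, DifferentiableAt ℝ (fun y => χ y * partialE i (fun y => R y k) y) x :=
      fun k => (dχ x).mul (dR1 k i x)
    have d3 : ∀ k, DifferentiableAt ℝ
        (fun y => χ y * partialE i (fun y => R y k) y * partialE k η (R y - z)) x :=
      fun k => (d2 k).mul (dηR1 k x)
    rw [funext (h1 i), partialE_add i d1 (DifferentiableAt.fun_sum fun k _ => d3 k),
      partialE_mul i (dχ1 i x) (dηR x), partialE_comp_sub (dR x) z (dη _),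
      partialE_sum i fun k _ => d3 k, add_assoc,
      Finset.mul_sum, ← Finset.sum_add_distrib]
    congr 1
    refine Finset.sum_congr rfl fun k _ => ?_
    rw [partialE_mul i (d2 k) (dηR1 k x), partialE_comp_sub (dR x) z (dη1 k _),
      Finset.mul_sum]
    have : ∀ l, χ x * partialE i (fun y => R y k) x *
        (partialE i (fun y => R y l) x * partialE l (partialE k η) (R x - z)) =
        χ x * (partialE i (fun y => R y l) x * partialE i (fun y => R y k) x) *
          partialE l (partialE k η) (R x - z) := fun l => by ring
    simp_rw [this]
    ring
  have dz : ∀ y : Eu d, DifferentiableAt ℝ (fun z => y - z) z := fun y =>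
    (differentiableAt_id (𝕜 := ℝ)).const_sub y
  have dηz : DifferentiableAt ℝ (fun z => η (R x - z)) z := (dη _).comp z (dz _)
  have dηz1 : ∀ k, DifferentiableAt ℝ (fun z => partialE k η (R x - z)) z :=
    fun k => (dη1 k _).comp z (dz _)
  have h3 : ∀ l, partialE l (branchFlux R χ η l x) z =
      ∑ k, χ x * pushMetric R l k x * partialE l (partialE k η) (R x - z) +
        branchDrift R χ l x * partialE l η (R x - z) := by
    intro l
    have e : branchFlux R χ η l x = fun z =>
      -(∑ k, χ x * pushMetric R l k x * partialE k η (R x - z) +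
        branchDrift R χ l x * η (R x - z)) := rfl
    rw [e, partialE_neg, partialE_add l (DifferentiableAt.fun_sum fun k _ =>
      (dηz1 k).const_mul _) (dηz.const_mul _), partialE_const_mul l _ dηz,
      partialE_const_sub (dη _), partialE_sum l fun k _ => (dηz1 k).const_mul _]
    have : ∀ k, partialE l (fun z => χ x * pushMetric R l k x * partialE k η (R x - z)) z =
        -(χ x * pushMetric R l k x * partialE l (partialE k η) (R x - z)) := fun k => by
      rw [partialE_const_mul l _ (dηz1 k), partialE_const_sub (dη1 k _)]
      ring
    simp_rw [this, Finset.sum_neg_distrib]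
    ring
  have e1 : ∑ i, ∑ k, (partialE i χ x * partialE i (fun y => R y k) x +
        partialE i (fun y => χ y * partialE i (fun y => R y k) y) x) * partialE k η (R x - z) =
      ∑ k, branchDrift R χ k x * partialE k η (R x - z) := by
    rw [Finset.sum_comm]
    exact Finset.sum_congr rfl fun k _ => by rw [branchDrift, Finset.sum_mul]
  have e2 : ∑ i, ∑ k, ∑ l, χ x * (partialE i (fun y => R y l) x * partialE i (fun y => R y k) x) *
        partialE l (partialE k η) (R x - z) =
      ∑ l, ∑ k, χ x * pushMetric R l k x * partialE l (partialE k η) (R x - z) := by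
    simp_rw [pushMetric, Finset.mul_sum, Finset.sum_mul]
    rw [Finset.sum_comm]
    rw [Finset.sum_comm (s := Finset.univ) (t := Finset.univ) (f := fun l k =>
      ∑ i, χ x * (partialE i (fun y => R y l) x * partialE i (fun y => R y k) x) *
        partialE l (partialE k η) (R x - z))]
    exact Finset.sum_congr rfl fun k _ => Finset.sum_comm
  rw [lapE_eq_sum]
  simp_rw [h2, h3, Finset.sum_add_distrib]
  rw [e1, e2, branchZero, lapE_eq_sum, Finset.sum_mul]
  ring

theorem branchFlux_error (hη : ContDiff ℝ (⊤ : ℕ∞) η) (l : Fin d) (x z : Eu d) :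
    ∑ k, A l k z * partialE k (branchKernel R χ η x) z - branchFlux R χ η l x z =
      -(∑ k, χ x * ((A l k z - pushMetric R l k x) * partialE k η (R x - z))) +
        branchDrift R χ l x * η (R x - z) := by
  have dη : ∀ y, DifferentiableAt ℝ η y := hη.differentiable (by simp)
  have dηz : DifferentiableAt ℝ (fun z => η (R x - z)) z :=
    (dη _).comp z ((differentiableAt_id (𝕜 := ℝ)).const_sub _)
  have h1 : ∀ k, partialE k (branchKernel R χ η x) z = -(χ x * partialE k η (R x - z)) := by
    intro k
    change partialE k (fun z => χ x * η (R x - z)) z = _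
    rw [partialE_const_mul k _ dηz, partialE_const_sub (dη _)]
    ring
  simp_rw [h1, branchFlux, sub_mul, mul_sub, Finset.sum_sub_distrib]
  have h2 : ∀ k, A l k z * -(χ x * partialE k η (R x - z)) =
      -(χ x * (A l k z * partialE k η (R x - z))) := fun k => by ring
  simp_rw [h2, Finset.sum_neg_distrib, mul_assoc]
  ring

theorem contDiff_comp_sub (hR : ContDiff ℝ (⊤ : ℕ∞) R) (hη : ContDiff ℝ (⊤ : ℕ∞) η) :
    ContDiff ℝ (⊤ : ℕ∞) (fun p : Eu d × Eu d => η (R p.1 - p.2)) :=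
  hη.comp ((hR.comp contDiff_fst).sub contDiff_snd)

theorem exists_bound_on (hb : IsBounded Ω) {G : Type*} [NormedAddCommGroup G] {φ : Eu d → G}
    (hφ : Continuous φ) :
    ∃ B, 0 ≤ B ∧ ∀ x ∈ Ω, ‖φ x‖ ≤ B := by
  obtain ⟨B, hB⟩ := hb.isCompact_closure.exists_bound_of_continuousOn hφ.continuousOn
  exact ⟨max B 0, le_max_right _ _, fun x hx => (hB x (subset_closure hx)).trans (le_max_left _ _)⟩

theorem Branch.exists_bounds (H : Branch Ω A c L R χ) (hA : ∀ k l, Continuous (A k l))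
    (hm : MeasurableSet Ω) (hb : IsBounded Ω) (hc : 0 ≤ c) (hL : 0 ≤ L) (hM : 0 ≤ M) :
    ∃ C r₀ : ℝ, 0 ≤ C ∧ ∀ ε η, 0 < ε → ε ≤ 1 → Mollifier M ε η → ∀ r, r₀ ≤ r →
      RegKernel Ω r (branchKernel R χ η) ∧ (∀ k, RegKernel Ω r (branchFlux R χ η k)) ∧
      RegKernel Ω r (branchZero R χ η) ∧
      SchurBound Ω C (branchKernel R χ η) ∧ SchurBound Ω C (branchZero R χ η) ∧
      ∀ l, SchurBound Ω C (fun x z =>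
        ∑ k, A l k z * partialE k (branchKernel R χ η x) z - branchFlux R χ η l x z) := by
  obtain ⟨BR, hBR0, hBR⟩ := exists_bound_on hb H.smooth_map.continuous
  obtain ⟨Bχ, hBχ0, hBχ⟩ := exists_bound_on hb H.smooth_cutoff.continuous
  obtain ⟨Bc, hBc0, hBc⟩ := exists_bound_on hb (contDiff_lapE H.smooth_cutoff).continuous
  have hdrift : ∀ l, ∃ B, 0 ≤ B ∧ ∀ x ∈ Ω, ‖branchDrift R χ l x‖ ≤ B := fun l =>
    exists_bound_on hb (contDiff_branchDrift H.smooth_map H.smooth_cutoff l).continuous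
  choose Bb hBb0 hBb using hdrift
  have hBb' : ∀ l, ∀ x ∈ Ω, |branchDrift R χ l x| ≤ ∑ l, Bb l := fun l x hx =>
    (hBb l x hx).trans (Finset.single_le_sum (fun k _ => hBb0 k) (Finset.mem_univ l))
  have hBs : 0 ≤ ∑ l, Bb l := Finset.sum_nonneg fun l _ => hBb0 l
  have hdL : 0 ≤ d * (Bχ * L) := by positivity
  let M' : ℝ := (Bχ + Bc + ∑ l, Bb l + d * (Bχ * L)) * M
  have hM' : 0 ≤ M' := by positivity
  refine ⟨M' ^ 2 * volume.real (Metric.ball (0 : Eu d) 1) ^ 2 * (2 * c) ^ d, BR + 1, by positivity,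
    fun ε η hε hε1 hη r hr => ?_⟩
  have far : ∀ x ∈ Ω, ∀ z, r < ‖z‖ → ε < ‖R x - z‖ := fun x hx z hz => by
    have h1 := hBR x hx
    have h2 := norm_sub_norm_le z (R x)
    rw [norm_sub_rev] at h2
    linarith
  have hη0 : ∀ x ∈ Ω, ∀ z, r < ‖z‖ → η (R x - z) = 0 := fun x hx z hz => hη.supp _ (far x hx z hz)
  have hη1 : ∀ k, ∀ x ∈ Ω, ∀ z, r < ‖z‖ → partialE k η (R x - z) = 0 := fun k x hx z hz =>
    hη.partialE_supp k (far x hx z hz)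
  have sη := contDiff_comp_sub H.smooth_map hη.smooth
  have regK : RegKernel Ω r (branchKernel R χ η) :=
    ⟨(H.smooth_cutoff.comp contDiff_fst).mul sη, fun x hx z hz => by
      rw [branchKernel, hη0 x hx z hz, mul_zero]⟩
  have regF : ∀ k, RegKernel Ω r (branchFlux R χ η k) := fun k =>
    ⟨((ContDiff.sum fun l _ => ((H.smooth_cutoff.comp contDiff_fst).mul
        ((contDiff_pushMetric H.smooth_map k l).comp contDiff_fst)).mul
        (contDiff_comp_sub H.smooth_map (hη.smooth.partialE l))).add
      (((contDiff_branchDrift H.smooth_map H.smooth_cutoff k).comp contDiff_fst).mul sη)).neg,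
      fun x hx z hz => by
        rw [branchFlux, hη0 x hx z hz, mul_zero, add_zero, neg_eq_zero]
        exact Finset.sum_eq_zero fun l _ => by rw [hη1 l x hx z hz, mul_zero]⟩
  have regZ : RegKernel Ω r (branchZero R χ η) :=
    ⟨((contDiff_lapE H.smooth_cutoff).comp contDiff_fst).mul sη, fun x hx z hz => by
      rw [branchZero, hη0 x hx z hz, mul_zero]⟩
  have hpos : 0 ≤ M * (ε ^ d)⁻¹ := by positivity
  have suppη : ∀ x z, η (R x - z) ≠ 0 → ‖R x - z‖ ≤ ε := fun x z h =>
    not_lt.1 fun h' => h (hη.supp _ h')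
  have suppη1 : ∀ k x z, partialE k η (R x - z) ≠ 0 → ‖R x - z‖ ≤ ε := fun k x z h =>
    not_lt.1 fun h' => h (hη.partialE_supp k h')
  refine ⟨regK, regF, regZ, ?_, ?_, fun l => ?_⟩
  · refine schurBound_of_supp (S := tsupport χ) (R := R) hm hb hc hM' hε regK.smooth.continuous
      regK.supp (fun x hx z => ?_) (fun x hx z h => ?_) H.antilipschitz
    · rw [branchKernel, abs_mul]
      refine (mul_le_mul (hBχ x hx) (hη.bound _) (abs_nonneg _) hBχ0).trans ?_
      rw [mul_assoc _ M]
      exact mul_le_mul_of_nonneg_right (by linarith) hpos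
    · exact ⟨subset_tsupport χ (left_ne_zero_of_mul h), suppη x z (right_ne_zero_of_mul h)⟩
  · refine schurBound_of_supp (S := tsupport χ) (R := R) hm hb hc hM' hε regZ.smooth.continuous
      regZ.supp (fun x hx z => ?_) (fun x hx z h => ?_) H.antilipschitz
    · rw [branchZero, abs_mul]
      refine (mul_le_mul (hBc x hx) (hη.bound _) (abs_nonneg _) hBc0).trans ?_
      rw [mul_assoc _ M]
      exact mul_le_mul_of_nonneg_right (by linarith) hpos
    · exact ⟨by_contra fun h0 => left_ne_zero_of_mul h (lapE_eq_zero h0),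
        suppη x z (right_ne_zero_of_mul h)⟩
  · refine schurBound_of_supp (S := tsupport χ) (R := R) (r := r) hm hb hc hM' hε ?_
      (fun x hx z hz => ?_) (fun x hx z => ?_) (fun x hx z h => ?_) H.antilipschitz
    · exact (continuous_finsetSum _ fun k _ => ((hA l k).comp continuous_snd).mul
        (regK.partialE k).smooth.continuous).sub (regF l).smooth.continuous
    · rw [(regF l).supp x hx z hz, sub_zero]
      exact Finset.sum_eq_zero fun k _ => by rw [(regK.partialE k).supp x hx z hz, mul_zero]
    · rw [branchFlux_error hη.smooth]
      have h1 : ∀ k, |χ x * ((A l k z - pushMetric R l k x) * partialE k η (R x - z))| ≤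
          Bχ * L * (M * (ε ^ d)⁻¹) := by
        intro k
        by_cases h0 : χ x = 0
        · rw [h0, zero_mul, abs_zero]; positivity
        by_cases h2 : partialE k η (R x - z) = 0
        · rw [h2, mul_zero, mul_zero, abs_zero]; positivity
        have h3 := suppη1 k x z h2
        have h4 := H.near x ⟨hx, subset_tsupport χ h0⟩ l k z
        have h5 : |A l k z - pushMetric R l k x| ≤ L * ε :=
          h4.trans (mul_le_mul_of_nonneg_left h3 hL)
        rw [abs_mul, abs_mul, mul_assoc]
        refine mul_le_mul (hBχ x hx) ((mul_le_mul h5 (hη.bound_partial k _) (abs_nonneg _)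
          (by positivity)).trans_eq ?_) (by positivity) hBχ0
        field_simp
      have h2 : |∑ k, χ x * ((A l k z - pushMetric R l k x) * partialE k η (R x - z))| ≤
          d * (Bχ * L * (M * (ε ^ d)⁻¹)) := by
        refine (Finset.abs_sum_le_sum_abs _ _).trans
          ((Finset.sum_le_sum fun k _ => h1 k).trans_eq ?_)
        simp
      have h3 : |branchDrift R χ l x * η (R x - z)| ≤ (∑ l, Bb l) * (M * (ε ^ d)⁻¹) := by
        rw [abs_mul]
        exact mul_le_mul (hBb' l x hx) (hη.bound _) (abs_nonneg _) hBs
      refine (abs_add_le _ _).trans ?_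
      rw [abs_neg]
      have h4 : 0 ≤ (Bχ + Bc) * (M * (ε ^ d)⁻¹) := by positivity
      calc _ ≤ d * (Bχ * L * (M * (ε ^ d)⁻¹)) + (∑ l, Bb l) * (M * (ε ^ d)⁻¹) := add_le_add h2 h3
        _ ≤ d * (Bχ * L * (M * (ε ^ d)⁻¹)) + (∑ l, Bb l) * (M * (ε ^ d)⁻¹) +
          (Bχ + Bc) * (M * (ε ^ d)⁻¹) := le_add_of_nonneg_right h4
        _ = _ := by ring
    · rw [branchFlux_error hη.smooth] at h
      constructor
      · by_contra h0
        refine h ?_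
        rw [branchDrift_eq_zero h0, image_eq_zero_of_notMem_tsupport h0]
        simp
      · by_contra h0
        refine h ?_
        rw [hη.supp _ (not_le.1 h0)]
        simp [hη.partialE_supp _ (not_le.1 h0)]

end Branch

section Combine

variable {d : ℕ} {Ω : Set (Eu d)} {r : ℝ}

theorem SchurBound.mono {C C' : ℝ} {K : Eu d → Eu d → ℝ} (h : SchurBound Ω C K) (hC : C ≤ C') :
    SchurBound Ω C' K := fun w hw hw2 =>
  (h w hw hw2).trans (mul_le_mul_of_nonneg_right hC (integral_nonneg fun _ => sq_nonneg _))

theorem SchurBound.add (hm : MeasurableSet Ω) (hb : IsBounded Ω) {C C' : ℝ}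
    {K K' : Eu d → Eu d → ℝ} (hK : Continuous (fun p : Eu d × Eu d => K p.1 p.2))
    (hs : ∀ x ∈ Ω, ∀ z, r < ‖z‖ → K x z = 0) (hK' : Continuous (fun p : Eu d × Eu d => K' p.1 p.2))
    (hs' : ∀ x ∈ Ω, ∀ z, r < ‖z‖ → K' x z = 0) (h : SchurBound Ω C K) (h' : SchurBound Ω C' K') :
    SchurBound Ω (2 * (C + C')) (fun x z => K x z + K' x z) := by
  intro w hw hw2
  have hwi := integrableOn_of_sq hb hw hw2
  have sq : ∀ {Q : Eu d → Eu d → ℝ}, Continuous (fun p : Eu d × Eu d => Q p.1 p.2) →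
      (∀ x ∈ Ω, ∀ z, r < ‖z‖ → Q x z = 0) → Integrable fun z => 2 * kint Ω w Q z ^ 2 := by
    intro Q hQ hsQ
    refine Continuous.integrable_of_hasCompactSupport
      (continuous_const.mul ((continuous_integral_kernel hm hb hQ hsQ hwi).pow 2)) ?_
    exact hasCompactSupport_of_norm_lt fun z hz => by rw [kint_eq_zero hm hsQ w hz]; simp
  have e : ∀ z, kint Ω w (fun x z => K x z + K' x z) z = kint Ω w K z + kint Ω w K' z := by
    intro z
    unfold kint
    rw [← integral_add (integrableOn_mul_kernel hm hb hK hs hwi z)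
      (integrableOn_mul_kernel hm hb hK' hs' hwi z)]
    simp_rw [mul_add]
  calc ∫ z, kint Ω w (fun x z => K x z + K' x z) z ^ 2
      ≤ ∫ z, (2 * kint Ω w K z ^ 2 + 2 * kint Ω w K' z ^ 2) := by
        refine integral_mono_of_nonneg (Eventually.of_forall fun _ => sq_nonneg _)
          ((sq hK hs).add (sq hK' hs')) (Eventually.of_forall fun z => ?_)
        simp only [e]
        nlinarith [sq_nonneg (kint Ω w K z - kint Ω w K' z)]
    _ = 2 * (∫ z, kint Ω w K z ^ 2) + 2 * ∫ z, kint Ω w K' z ^ 2 := by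
        rw [integral_add (sq hK hs) (sq hK' hs'), integral_const_mul, integral_const_mul]
    _ ≤ _ := by
        have := h w hw hw2
        have := h' w hw hw2
        linarith

theorem Mollifier.abs_integral_sub_le {M ε L : ℝ} {η F : Eu d → ℝ} (hη : Mollifier M ε η)
    (hL : 0 ≤ L) (hF : ∀ x y, |F x - F y| ≤ L * ‖x - y‖) (y : Eu d) :
    |(∫ z, η (y - z) * F z) - F y| ≤ L * ε := by
  have hFc : Continuous F := by
    refine (LipschitzWith.of_dist_le_mul (K := L.toNNReal) fun a b => ?_).continuous
    rw [Real.coe_toNNReal L hL, dist_eq_norm, dist_eq_norm]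
    exact hF a b
  have hηc : Continuous fun z => η (y - z) := hη.smooth.continuous.comp (by fun_prop)
  have hcs : HasCompactSupport fun z => η (y - z) := by
    refine HasCompactSupport.intro (isCompact_closedBall y ε) fun z hz => hη.supp _ ?_
    rw [norm_sub_rev, ← dist_eq_norm]
    simpa using hz
  have h1 : ∫ z, η (y - z) = 1 := by rw [integral_sub_left_eq_self η]; exact hη.integral_eq
  have i0 : Integrable fun z => η (y - z) := hηc.integrable_of_hasCompactSupport hcs
  have i1 : Integrable fun z => η (y - z) * F z :=
    (hηc.mul hFc).integrable_of_hasCompactSupport hcs.mul_right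
  have e : (∫ z, η (y - z) * F z) - F y = ∫ z, η (y - z) * (F z - F y) := by
    simp_rw [mul_sub]
    rw [integral_sub i1 (i0.mul_const _), integral_mul_const, h1, one_mul]
  rw [e, ← Real.norm_eq_abs]
  refine (norm_integral_le_of_norm_le (i0.mul_const (L * ε))
    (Eventually.of_forall fun z => ?_)).trans_eq ?_
  · rw [norm_mul, Real.norm_eq_abs, abs_of_nonneg (hη.nonneg _)]
    by_cases hz : ε < ‖y - z‖
    · rw [hη.supp _ hz]; simp
    refine mul_le_mul_of_nonneg_left ((hF z y).trans ?_) (hη.nonneg _)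
    rw [norm_sub_rev]
    exact mul_le_mul_of_nonneg_left (not_lt.1 hz) hL
  · rw [integral_mul_const, h1, one_mul]

theorem lapE_add {f g : Eu d → ℝ} (hf : ContDiff ℝ (⊤ : ℕ∞) f) (hg : ContDiff ℝ (⊤ : ℕ∞) g)
    (x : Eu d) : lapE (fun y => f y + g y) x = lapE f x + lapE g x := by
  have h1 : ∀ i, partialE i (fun y => f y + g y) = fun y => partialE i f y + partialE i g y :=
    fun i => funext fun y => partialE_add i (hf.differentiable (by simp) y)
      (hg.differentiable (by simp) y)
  simp_rw [lapE_eq_sum, h1]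
  rw [← Finset.sum_add_distrib]
  exact Finset.sum_congr rfl fun i _ => partialE_add i
    ((hf.partialE i).differentiable (by simp) x) ((hg.partialE i).differentiable (by simp) x)

theorem exists_energyKernel {ζ : Eu d → ℝ} {A : Fin d → Fin d → Eu d → ℝ} {c L : ℝ}
    {R : Eu d → Eu d} {χ : Eu d → ℝ} (hm : MeasurableSet Ω) (hb : IsBounded Ω) (hc : 0 ≤ c)
    (hL : 0 ≤ L) (hA : ∀ k l, Continuous (A k l))
    (hell : ∀ z, ∀ ξ : Fin d → ℝ, (1 / 2) * ∑ k, ξ k ^ 2 ≤ ∑ k, ξ k * ∑ l, A k l z * ξ l)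
    (H₀ : Branch Ω A c L (fun x => x) (fun _ => 1)) (H₁ : Branch Ω A c L R χ)
    (hfix : ∀ x ∈ frontier Ω, R x = x) (hone : ∀ x ∈ frontier Ω, χ x = 1)
    (hflat : ∀ x ∈ frontier Ω, fderiv ℝ χ x = 0)
    (hrefl : ∀ x ∈ frontier Ω, fderiv ℝ R x (unitNormal ζ x) = -unitNormal ζ x)
    (hout : ∀ x ∈ Ω, χ x ≠ 0 → R x ∉ Ω) :
    ∃ C : ℝ, 0 ≤ C ∧ ∀ ε : ℝ, 0 < ε → ε ≤ 1 →
      ∃ r h P f A, EnergyKernel ζ Ω C ε r h P f A := by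
  obtain ⟨M, hM, hmol⟩ := exists_mollifier d
  obtain ⟨C₀, r₀, hC₀, h₀⟩ := H₀.exists_bounds hA hm hb hc hL hM
  obtain ⟨C₁, r₁, hC₁, h₁⟩ := H₁.exists_bounds hA hm hb hc hL hM
  obtain ⟨B, hB, hBχ⟩ := exists_bound_on hb H₁.smooth_cutoff.continuous
  refine ⟨2 * (C₀ + C₁) + (1 + B), by positivity, fun ε hε hε1 => ?_⟩
  obtain ⟨η, hη⟩ := hmol ε hε
  obtain ⟨reg₀, regF₀, regZ₀, s₀, sZ₀, sE₀⟩ := h₀ ε η hε hε1 hη (max r₀ r₁) (le_max_left _ _)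
  obtain ⟨reg₁, regF₁, regZ₁, s₁, sZ₁, sE₁⟩ := h₁ ε η hε hε1 hη (max r₀ r₁) (le_max_right _ _)
  have hle : 2 * (C₀ + C₁) ≤ 2 * (C₀ + C₁) + (1 + B) := by linarith
  have smx : ∀ {r : ℝ} {K : Eu d → Eu d → ℝ}, RegKernel Ω r K → ∀ z,
      ContDiff ℝ (⊤ : ℕ∞) (fun y => K y z) := fun hK z =>
    hK.smooth.comp (contDiff_id.prodMk contDiff_const)
  have smz : ∀ {r : ℝ} {K : Eu d → Eu d → ℝ}, RegKernel Ω r K → ∀ x,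
      ContDiff ℝ (⊤ : ℕ∞) (K x) := fun hK x =>
    hK.smooth.comp (contDiff_const.prodMk contDiff_id)
  have err : ∀ {K : Eu d → Eu d → ℝ} {P : Eu d → Eu d → ℝ}, RegKernel Ω (max r₀ r₁) K →
      RegKernel Ω (max r₀ r₁) P → ∀ k,
      Continuous (fun p : Eu d × Eu d => ∑ l, A k l p.2 * partialE l (K p.1) p.2 - P p.1 p.2) ∧
      ∀ x ∈ Ω, ∀ z, max r₀ r₁ < ‖z‖ → ∑ l, A k l z * partialE l (K x) z - P x z = 0 := by
    intro K P hK hP k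
    refine ⟨(continuous_finsetSum _ fun l _ => ((hA k l).comp continuous_snd).mul
        (hK.partialE l).smooth.continuous).sub hP.smooth.continuous, fun x hx z hz => ?_⟩
    rw [hP.supp x hx z hz, sub_zero]
    exact Finset.sum_eq_zero fun l _ => by rw [(hK.partialE l).supp x hx z hz, mul_zero]
  refine ⟨max r₀ r₁,
    fun x z => branchKernel (fun x => x) (fun _ => 1) η x z + branchKernel R χ η x z,
    fun k x z => branchFlux (fun x => x) (fun _ => 1) η k x z + branchFlux R χ η k x z,
    fun x z => branchZero (fun x => x) (fun _ => 1) η x z + branchZero R χ η x z, A,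
    { reg := reg₀.add reg₁
      reg_flux := fun k => (regF₀ k).add (regF₁ k)
      reg_zero := regZ₀.add regZ₁
      neumann := ?_
      lap := ?_
      cont := hA
      elliptic := hell
      schur := (SchurBound.add hm hb reg₀.smooth.continuous reg₀.supp reg₁.smooth.continuous
        reg₁.supp s₀ s₁).mono hle
      schur_zero := (SchurBound.add hm hb regZ₀.smooth.continuous regZ₀.supp
        regZ₁.smooth.continuous regZ₁.supp sZ₀ sZ₁).mono hle
      schur_error := ?_
      approx := ?_ }⟩
  · intro z x hx
    have dη : DifferentiableAt ℝ η (x - z) := hη.smooth.differentiable (by simp) _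
    have dχ := (H₁.smooth_cutoff.differentiable (by simp) x).hasFDerivAt
    have dR := (H₁.smooth_map.differentiable (by simp) x).hasFDerivAt
    have d1 : HasFDerivAt (fun y => η (y - z)) (fderiv ℝ η (x - z)) x :=
      dη.hasFDerivAt.comp x ((hasFDerivAt_id (𝕜 := ℝ) x).sub_const z)
    have dη' : HasFDerivAt η (fderiv ℝ η (x - z)) (R x - z) := by
      rw [hfix x hx]; exact dη.hasFDerivAt
    have d2 : HasFDerivAt (fun y => η (R y - z)) ((fderiv ℝ η (x - z)).comp (fderiv ℝ R x)) x :=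
      dη'.comp x (dR.sub_const z)
    have d3 := (d1.const_mul 1).add (dχ.mul d2)
    have d4 : fderiv ℝ (fun y => branchKernel (fun x => x) (fun _ => 1) η y z +
      branchKernel R χ η y z) x = _ := d3.fderiv
    rw [d4, hone x hx, hflat x hx]
    simp [hrefl x hx]
  · intro x _ z
    have e := lapE_add (smx reg₀ z) (smx reg₁ z) x
    rw [e, lapE_branchKernel H₀.smooth_map H₀.smooth_cutoff hη.smooth,
      lapE_branchKernel H₁.smooth_map H₁.smooth_cutoff hη.smooth]
    have e2 : ∀ k, partialE k (fun z => branchFlux (fun x => x) (fun _ => 1) η k x z +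
        branchFlux R χ η k x z) z = partialE k (branchFlux (fun x => x) (fun _ => 1) η k x) z +
        partialE k (branchFlux R χ η k x) z := fun k =>
      partialE_add k ((smz (regF₀ k) x).differentiable (by simp) z)
        ((smz (regF₁ k) x).differentiable (by simp) z)
    simp_rw [e2, Finset.sum_add_distrib]
    ring
  · intro k
    obtain ⟨c0, z0⟩ := err reg₀ (regF₀ k) k
    obtain ⟨c1, z1⟩ := err reg₁ (regF₁ k) k
    have := (SchurBound.add hm hb c0 z0 c1 z1 (sE₀ k) (sE₁ k)).mono hle
    convert this using 3 with x z
    have e2 : ∀ l, partialE l (fun z => branchKernel (fun x => x) (fun _ => 1) η x z +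
        branchKernel R χ η x z) z = partialE l (branchKernel (fun x => x) (fun _ => 1) η x) z +
        partialE l (branchKernel R χ η x) z := fun l =>
      partialE_add l ((smz reg₀ x).differentiable (by simp) z)
        ((smz reg₁ x).differentiable (by simp) z)
    simp_rw [e2, mul_add, Finset.sum_add_distrib]
    ring
  · intro F L' hL' hF hF0 x hx
    have hFc : Continuous F := by
      refine (LipschitzWith.of_dist_le_mul (K := L'.toNNReal) fun a b => ?_).continuous
      rw [Real.coe_toNNReal L' hL', dist_eq_norm, dist_eq_norm]
      exact hF a b
    have int : ∀ {K : Eu d → Eu d → ℝ}, RegKernel Ω (max r₀ r₁) K →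
        Integrable fun z => K x z * F z := fun hK =>
      (((smz hK x).continuous).mul hFc).integrable_of_hasCompactSupport
        (hasCompactSupport_of_norm_lt fun z hz => hK.supp x hx z hz).mul_right
    have e : ∫ z, (branchKernel (fun x => x) (fun _ => 1) η x z + branchKernel R χ η x z) * F z =
        (∫ z, η (x - z) * F z) + χ x * ∫ z, η (R x - z) * F z := by
      simp_rw [add_mul]
      rw [integral_add (int reg₀) (int reg₁), ← integral_const_mul]
      simp [branchKernel, mul_assoc]
    have b0 := hη.abs_integral_sub_le hL' hF x
    have b1 := hη.abs_integral_sub_le hL' hF (R x)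
    have hLε : 0 ≤ L' * ε := by positivity
    have b2 : |χ x * ∫ z, η (R x - z) * F z| ≤ B * (L' * ε) := by
      by_cases h0 : χ x = 0
      · rw [h0, zero_mul, abs_zero]; positivity
      rw [hF0 _ (hout x hx h0), sub_zero] at b1
      rw [abs_mul]
      exact mul_le_mul (hBχ x hx) b1 (abs_nonneg _) hB
    rw [e, add_sub_right_comm]
    refine (abs_add_le _ _).trans ((add_le_add b0 b2).trans ?_)
    have : 0 ≤ 2 * (C₀ + C₁) * (L' * ε) := by positivity
    linarith

end Combine

theorem exists_lipschitz_on_closedBall {E G : Type*} [NormedAddCommGroup E] [NormedSpace ℝ E]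
    [ProperSpace E] [NormedAddCommGroup G] [NormedSpace ℝ G] {f : E → G}
    (hf : ContDiff ℝ (⊤ : ℕ∞) f) (ρ : ℝ) :
    ∃ C, 0 ≤ C ∧ ∀ x ∈ Metric.closedBall (0 : E) ρ, ∀ y ∈ Metric.closedBall (0 : E) ρ,
      ‖f x - f y‖ ≤ C * ‖x - y‖ := by
  obtain ⟨C, hC⟩ := (isCompact_closedBall (0 : E) ρ).exists_bound_of_continuousOn
    (hf.continuous_fderiv (by simp)).continuousOn
  refine ⟨max C 0, le_max_right _ _, fun x hx y hy => ?_⟩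
  exact (convex_closedBall (0 : E) ρ).norm_image_sub_le_of_norm_fderiv_le (𝕜 := ℝ)
    (fun z _ => hf.differentiable (by simp) z) (fun z hz => (hC z hz).trans (le_max_left _ _)) hy hx

theorem exists_taylor_on_closedBall {E G : Type*} [NormedAddCommGroup E] [NormedSpace ℝ E]
    [ProperSpace E] [NormedAddCommGroup G] [NormedSpace ℝ G] {f : E → G}
    (hf : ContDiff ℝ (⊤ : ℕ∞) f) (ρ : ℝ) :
    ∃ C, 0 ≤ C ∧ ∀ x ∈ Metric.closedBall (0 : E) ρ, ∀ y ∈ Metric.closedBall (0 : E) ρ,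
      ‖f y - f x - fderiv ℝ f x (y - x)‖ ≤ C * ‖y - x‖ ^ 2 := by
  obtain ⟨C, hC0, hC⟩ := exists_lipschitz_on_closedBall
    (hf.fderiv_right (m := (⊤ : ℕ∞)) (by simp)) ρ
  refine ⟨C, hC0, fun x hx y hy => ?_⟩
  have hsub : segment ℝ x y ⊆ Metric.closedBall (0 : E) ρ :=
    (convex_closedBall (0 : E) ρ).segment_subset hx hy
  have := (convex_segment x y).norm_image_sub_le_of_norm_fderiv_le' (𝕜 := ℝ) (f := f)
    (φ := fderiv ℝ f x) (C := C * ‖y - x‖) (fun z _ => hf.differentiable (by simp) z)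
    (fun z hz => (hC z (hsub hz) x hx).trans
      (mul_le_mul_of_nonneg_left (norm_sub_le_of_mem_segment hz) hC0))
    (left_mem_segment ℝ x y) (right_mem_segment ℝ x y)
  rwa [mul_assoc, ← sq] at this

theorem exists_lipschitz_factorization {ι E : Type*} [NormedAddCommGroup E] {p : ι → E}
    {F : ι → ℝ} {L : ℝ} (hL : 0 ≤ L) (h : ∀ a b, |F a - F b| ≤ L * ‖p a - p b‖) :
    ∃ G : E → ℝ, (∀ x y, |G x - G y| ≤ L * ‖x - y‖) ∧ ∀ a, G (p a) = F a := by
  have hfac : F.FactorsThrough p := fun a b hab => by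
    have := h a b
    rw [hab, sub_self, norm_zero, mul_zero] at this
    exact sub_eq_zero.1 (abs_nonpos_iff.1 this)
  have hlip : LipschitzOnWith L.toNNReal (Function.extend p F 0) (range p) := by
    refine LipschitzOnWith.of_dist_le_mul ?_
    rintro _ ⟨a, rfl⟩ _ ⟨b, rfl⟩
    rw [hfac.extend_apply, hfac.extend_apply, Real.coe_toNNReal L hL, dist_eq_norm, dist_eq_norm]
    exact h a b
  obtain ⟨G, hG, hGF⟩ := hlip.extend_real
  refine ⟨G, fun x y => ?_, fun a => ?_⟩
  · have := hG.dist_le_mul x y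
    rwa [Real.coe_toNNReal L hL, dist_eq_norm, dist_eq_norm] at this
  · rw [← hGF (mem_range_self a), hfac.extend_apply]

theorem norm_sub_two_inner_smul {E : Type*} [NormedAddCommGroup E] [InnerProductSpace ℝ E] {g : E}
    (hg : g ≠ 0) (v : E) : ‖v - (2 * ⟪g, v⟫) • (‖g‖ ^ 2)⁻¹ • g‖ = ‖v‖ := by
  have hg' : ‖g‖ ≠ 0 := norm_ne_zero_iff.2 hg
  rw [← sq_eq_sq₀ (norm_nonneg _) (norm_nonneg _), smul_smul, norm_sub_sq_real, norm_smul,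
    real_inner_smul_right, real_inner_comm, mul_pow, Real.norm_eq_abs, sq_abs]
  field_simp
  ring

/-- The gradient of `f`, in coordinates. -/
def gradE {d : ℕ} (f : Eu d → ℝ) (x : Eu d) : Eu d := ∑ k, partialE k f x • basisE d k

section Gradient

variable {d : ℕ} {f : Eu d → ℝ}

theorem gradE_apply (x : Eu d) (k : Fin d) : gradE f x k = partialE k f x := by
  simp [gradE, basisE, Pi.single_apply]

theorem inner_gradE (x v : Eu d) : ⟪gradE f x, v⟫ = fderiv ℝ f x v := by
  rw [clm_apply_eq_sum, PiLp.inner_apply]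
  simp [gradE_apply, partialE]

theorem gradient_eq_gradE (x : Eu d) : gradient f x = gradE f x := by
  refine ext_inner_right ℝ fun v => ?_
  rw [inner_gradE, gradient]
  exact InnerProductSpace.toDual_symm_apply

theorem norm_sq_gradE (x : Eu d) : ‖gradE f x‖ ^ 2 = ∑ k, partialE k f x ^ 2 := by
  simp [EuclideanSpace.norm_sq_eq, gradE_apply]

theorem contDiff_gradE (hf : ContDiff ℝ (⊤ : ℕ∞) f) : ContDiff ℝ (⊤ : ℕ∞) (gradE f) :=
  ContDiff.sum fun k _ => (hf.partialE k).smul contDiff_const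

/-- A smooth field which equals `∇f / |∇f|²` wherever `a ≤ |∇f|²`. -/
theorem exists_normal_field (hf : ContDiff ℝ (⊤ : ℕ∞) f) {a : ℝ} (ha : 0 < a) :
    ∃ N : Eu d → Eu d, ContDiff ℝ (⊤ : ℕ∞) N ∧
      ∀ x, a ≤ ‖gradE f x‖ ^ 2 → N x = (‖gradE f x‖ ^ 2)⁻¹ • gradE f x := by
  have hq : ContDiff ℝ (⊤ : ℕ∞) fun x => ‖gradE f x‖ ^ 2 := (contDiff_gradE hf).norm_sq ℝ
  have hpos : ∀ s : ℝ, 0 ≤ s → s + (1 - smoothTransition (s / a)) ≠ 0 := by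
    intro s hs
    have h1 := smoothTransition.le_one (s / a)
    rcases hs.eq_or_lt with rfl | hs
    · simp [smoothTransition.zero_of_nonpos le_rfl]
    · linarith
  refine ⟨fun x => (‖gradE f x‖ ^ 2 + (1 - smoothTransition (‖gradE f x‖ ^ 2 / a)))⁻¹ • gradE f x,
    ContDiff.smul (ContDiff.inv (hq.add (contDiff_const.sub
      (smoothTransition.contDiff.comp (hq.div_const a)))) fun x => hpos _ (sq_nonneg _))
      (contDiff_gradE hf), fun x hx => ?_⟩
  simp [smoothTransition.one_of_one_le ((one_le_div ha).2 hx)]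

end Gradient

/-- Reflection across the zero level of `ζ` along the field `N`. -/
def reflE {d : ℕ} (ζ : Eu d → ℝ) (N : Eu d → Eu d) (x : Eu d) : Eu d := x - (2 * ζ x) • N x

section Reflection

variable {d : ℕ} {ζ : Eu d → ℝ} {N : Eu d → Eu d}

theorem contDiff_reflE (hζ : ContDiff ℝ (⊤ : ℕ∞) ζ) (hN : ContDiff ℝ (⊤ : ℕ∞) N) :
    ContDiff ℝ (⊤ : ℕ∞) (reflE ζ N) :=
  contDiff_id.sub ((contDiff_const.mul hζ).smul hN)

theorem partialE_reflE (hζ : ContDiff ℝ (⊤ : ℕ∞) ζ) (hN : ContDiff ℝ (⊤ : ℕ∞) N) (i k : Fin d)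
    (x : Eu d) : partialE i (fun y => reflE ζ N y k) x =
      (if i = k then 1 else 0) -
        2 * (partialE i ζ x * N x k + ζ x * partialE i (fun y => N y k) x) := by
  have h1 : HasFDerivAt (fun y : Eu d => y k) (EuclideanSpace.proj k : Eu d →L[ℝ] ℝ) x :=
    (EuclideanSpace.proj k : Eu d →L[ℝ] ℝ).hasFDerivAt
  have h2 := (hζ.differentiable (by simp) x).hasFDerivAt
  have h3 := ((contDiff_coord hN k).differentiable (by simp) x).hasFDerivAt
  have h4 := h1.sub ((h2.const_mul 2).mul h3)
  have h5 : fderiv ℝ (fun y => reflE ζ N y k) x = _ := h4.fderiv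
  rw [partialE, h5]
  simp [partialE, basisE, eq_comm]
  ring

theorem sum_reflection_mul {g n : Fin d → ℝ} (hn : ∀ k, n k = (∑ i, g i ^ 2)⁻¹ * g k)
    (hg : ∑ i, g i ^ 2 ≠ 0) (k l : Fin d) :
    ∑ i, ((if i = k then 1 else 0) - 2 * (g i * n k)) *
        ((if i = l then 1 else 0) - 2 * (g i * n l)) =
      if k = l then (1 : ℝ) else 0 := by
  have e : ∀ i, ((if i = k then (1 : ℝ) else 0) - 2 * (g i * n k)) *
      ((if i = l then 1 else 0) - 2 * (g i * n l)) =
      (if i = k then (if i = l then (1 : ℝ) else 0) else 0) -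
      (if i = k then 2 * (g i * n l) else 0) - (if i = l then 2 * (g i * n k) else 0) +
      4 * n k * n l * g i ^ 2 := by
    intro i
    split_ifs <;> ring
  simp_rw [e, Finset.sum_add_distrib, Finset.sum_sub_distrib, ← Finset.mul_sum]
  simp only [Finset.sum_ite_eq', Finset.mem_univ, if_true]
  rw [hn k, hn l]
  generalize ∑ i, g i ^ 2 = q at hg
  field_simp
  ring

theorem exists_pushMetric_reflE_sub (hζ : ContDiff ℝ (⊤ : ℕ∞) ζ) (hN : ContDiff ℝ (⊤ : ℕ∞) N)
    (k l : Fin d) : ∃ e : Eu d → ℝ, Continuous e ∧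
      ∀ x, gradE ζ x ≠ 0 → N x = (‖gradE ζ x‖ ^ 2)⁻¹ • gradE ζ x →
        pushMetric (reflE ζ N) k l x - (if k = l then 1 else 0) = ζ x * e x := by
  have cN : ∀ k, Continuous fun y => N y k := fun k => (contDiff_coord hN k).continuous
  have cN1 : ∀ i k, Continuous (partialE i fun y => N y k) := fun i k =>
    ((contDiff_coord hN k).partialE i).continuous
  have cζ1 : ∀ i, Continuous (partialE i ζ) := fun i => (hζ.partialE i).continuous
  refine ⟨fun x => ∑ i, (-2 * partialE i (fun y => N y l) x *
      ((if i = k then 1 else 0) - 2 * (partialE i ζ x * N x k)) -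
      2 * partialE i (fun y => N y k) x *
        ((if i = l then 1 else 0) - 2 * (partialE i ζ x * N x l)) +
      4 * ζ x * partialE i (fun y => N y k) x * partialE i (fun y => N y l) x),
    continuous_finsetSum _ fun i _ => ?_, fun x hx hNx => ?_⟩
  · have := hζ.continuous
    have := cN k
    have := cN l
    have := cN1 i k
    have := cN1 i l
    have := cζ1 i
    fun_prop
  · have hs : ∑ i, partialE i ζ x ^ 2 ≠ 0 := by
      rw [← norm_sq_gradE]
      exact pow_ne_zero 2 (norm_ne_zero_iff.2 hx)
    have hn : ∀ k, N x k = (∑ i, partialE i ζ x ^ 2)⁻¹ * partialE k ζ x := fun k => by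
      rw [hNx, norm_sq_gradE, PiLp.smul_apply, gradE_apply, smul_eq_mul]
    rw [← sum_reflection_mul hn hs k l, pushMetric, ← Finset.sum_sub_distrib, Finset.mul_sum]
    refine Finset.sum_congr rfl fun i _ => ?_
    rw [partialE_reflE hζ hN, partialE_reflE hζ hN]
    ring

theorem fderiv_reflE_of_eq_zero (hζ : ContDiff ℝ (⊤ : ℕ∞) ζ) (hN : ContDiff ℝ (⊤ : ℕ∞) N)
    {x : Eu d} (hx : ζ x = 0) (v : Eu d) :
    fderiv ℝ (reflE ζ N) x v = v - (2 * fderiv ℝ ζ x v) • N x := by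
  have h2 := (hζ.differentiable (by simp) x).hasFDerivAt
  have h3 := (hN.differentiable (by simp) x).hasFDerivAt
  have h4 := (hasFDerivAt_id (𝕜 := ℝ) x).sub ((h2.const_mul 2).smul h3)
  have h5 : fderiv ℝ (reflE ζ N) x = _ := h4.fderiv
  rw [h5]
  simp [hx]

theorem fderiv_reflE_unitNormal (hζ : ContDiff ℝ (⊤ : ℕ∞) ζ) (hN : ContDiff ℝ (⊤ : ℕ∞) N)
    {x : Eu d} (hx : ζ x = 0) (hg : gradE ζ x ≠ 0)
    (hNx : N x = (‖gradE ζ x‖ ^ 2)⁻¹ • gradE ζ x) :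
    fderiv ℝ (reflE ζ N) x (unitNormal ζ x) = -unitNormal ζ x := by
  have hg' : ‖gradE ζ x‖ ≠ 0 := norm_ne_zero_iff.2 hg
  rw [fderiv_reflE_of_eq_zero hζ hN hx, unitNormal, gradient_eq_gradE, map_smul, ← inner_gradE,
    real_inner_self_eq_norm_sq, hNx, smul_smul, ← sub_smul, ← neg_smul]
  congr 1
  simp
  field_simp
  ring

end Reflection

section Layer

variable {d : ℕ} {ζ : Eu d → ℝ} {Ω : Set (Eu d)}

theorem eq_zero_of_mem_frontier (hζ : Continuous ζ) (hΩ : Ω = {x | ζ x < 0}) {x : Eu d}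
    (hx : x ∈ frontier Ω) : ζ x = 0 := by
  subst hΩ
  exact frontier_lt_subset_eq hζ continuous_const hx

theorem mem_frontier_of_eq_zero (hζ : Continuous ζ) (hΩ : Ω = {x | ζ x < 0}) {x : Eu d}
    (hx : x ∈ closure Ω) (h0 : ζ x = 0) : x ∈ frontier Ω := by
  have ho : IsOpen Ω := hΩ ▸ isOpen_lt hζ continuous_const
  rw [ho.frontier_eq]
  exact ⟨hx, by simp [hΩ, h0]⟩

theorem exists_layer (hζ : ContDiff ℝ (⊤ : ℕ∞) ζ) (hΩ : Ω = {x | ζ x < 0}) (hb : IsBounded Ω)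
    (hgrad : ∀ x ∈ frontier Ω, gradient ζ x ≠ 0) :
    ∃ a : ℝ, 0 < a ∧ ∀ x ∈ closure Ω, |ζ x| ≤ a → a ≤ ‖gradE ζ x‖ ^ 2 := by
  rcases (closure Ω).eq_empty_or_nonempty with h | hne
  · exact ⟨1, one_pos, by simp [h]⟩
  have hc : Continuous fun x => |ζ x| + ‖gradE ζ x‖ ^ 2 :=
    hζ.continuous.abs.add ((contDiff_gradE hζ).continuous.norm.pow 2)
  obtain ⟨x₀, hx₀, hmin⟩ := hb.isCompact_closure.exists_isMinOn hne hc.continuousOn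
  have hpos : 0 < |ζ x₀| + ‖gradE ζ x₀‖ ^ 2 := by
    by_cases h0 : ζ x₀ = 0
    · have := hgrad x₀ (mem_frontier_of_eq_zero hζ.continuous hΩ hx₀ h0)
      rw [gradient_eq_gradE] at this
      have := norm_pos_iff.2 this
      positivity
    · have := abs_pos.2 h0
      positivity
  refine ⟨(|ζ x₀| + ‖gradE ζ x₀‖ ^ 2) / 2, by positivity, fun x hx h => ?_⟩
  have : |ζ x₀| + ‖gradE ζ x₀‖ ^ 2 ≤ |ζ x| + ‖gradE ζ x‖ ^ 2 := hmin hx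
  linarith

/-- Quantitative properties of the reflection on a thin interior layer of the boundary. -/
structure ReflectionLayer (ζ : Eu d → ℝ) (N : Eu d → Eu d) (Ω : Set (Eu d)) (δ κ L : ℝ) : Prop where
  outside : ∀ x ∈ Ω, |ζ x| ≤ δ → reflE ζ N x ∉ Ω
  antilipschitz : ∀ x ∈ Ω, |ζ x| ≤ δ → ∀ y ∈ Ω, |ζ y| ≤ δ →
    ‖x - y‖ ≤ 2 * ‖reflE ζ N x - reflE ζ N y‖
  small : ∀ k l, ∀ x ∈ Ω, |ζ x| ≤ δ →
    |pushMetric (reflE ζ N) k l x - (if k = l then 1 else 0)| ≤ κ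
  dist : ∀ k l, ∀ x ∈ Ω, |ζ x| ≤ δ → ∀ y ∈ Ω,
    |pushMetric (reflE ζ N) k l x - (if k = l then 1 else 0)| ≤ L * ‖reflE ζ N x - y‖
  lipschitz : ∀ k l, ∀ x ∈ Ω, |ζ x| ≤ δ → ∀ y ∈ Ω, |ζ y| ≤ δ →
    |pushMetric (reflE ζ N) k l x - pushMetric (reflE ζ N) k l y| ≤
      L * ‖reflE ζ N x - reflE ζ N y‖

theorem exists_reflectionLayer (hζ : ContDiff ℝ (⊤ : ℕ∞) ζ) (hΩ : Ω = {x | ζ x < 0})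
    (hb : IsBounded Ω) {N : Eu d → Eu d} (hN : ContDiff ℝ (⊤ : ℕ∞) N) {a : ℝ} (ha : 0 < a)
    (hlayer : ∀ x ∈ closure Ω, |ζ x| ≤ a → gradE ζ x ≠ 0 ∧
      N x = (‖gradE ζ x‖ ^ 2)⁻¹ • gradE ζ x) {κ : ℝ} (hκ : 0 < κ) :
    ∃ δ L : ℝ, 0 < δ ∧ δ ≤ a ∧ 0 ≤ L ∧ ReflectionLayer ζ N Ω δ κ L := by
  obtain ⟨BN, hBN0, hBN⟩ := exists_bound_on hb hN.continuous
  obtain ⟨BR, hBR0, hBR⟩ := exists_bound_on hb (contDiff_reflE hζ hN).continuous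
  obtain ⟨BI, hBI0, hBI⟩ := exists_bound_on hb (continuous_id (X := Eu d))
  choose e hec he using exists_pushMetric_reflE_sub hζ hN
  choose Be hBe0 hBe using fun k l => exists_bound_on hb (hec k l)
  have hmemΩ : ∀ x ∈ Ω, x ∈ Metric.closedBall (0 : Eu d) (BR + BI) := fun x hx => by
    have h : ‖x‖ ≤ BI := hBI x hx
    rw [mem_closedBall_zero_iff]
    linarith
  have hmemR : ∀ x ∈ Ω, reflE ζ N x ∈ Metric.closedBall (0 : Eu d) (BR + BI) := fun x hx => by
    have h := hBR x hx
    rw [mem_closedBall_zero_iff]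
    linarith
  obtain ⟨CT, hCT0, hCT⟩ := exists_taylor_on_closedBall hζ (BR + BI)
  obtain ⟨Lζ, hLζ0, hLζ⟩ := exists_lipschitz_on_closedBall hζ (BR + BI)
  obtain ⟨LN, hLN0, hLN⟩ := exists_lipschitz_on_closedBall hN (BR + BI)
  choose LG hLG0 hLG using fun k l => exists_lipschitz_on_closedBall
    (contDiff_pushMetric (contDiff_reflE hζ hN) k l) (BR + BI)
  have single : ∀ {F : Fin d → Fin d → ℝ}, (∀ k l, 0 ≤ F k l) → ∀ k l,
      F k l ≤ ∑ k, ∑ l, F k l := fun {F} hF k l =>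
    (Finset.single_le_sum (f := F k) (fun l _ => hF k l) (Finset.mem_univ l)).trans
      (Finset.single_le_sum (f := fun k => ∑ l, F k l)
        (fun k _ => Finset.sum_nonneg fun l _ => hF k l) (Finset.mem_univ k))
  have hBe' := single hBe0
  have hLG' := single hLG0
  generalize ∑ k, ∑ l, Be k l = E at hBe'
  generalize ∑ k, ∑ l, LG k l = G at hLG'
  obtain ⟨E, hE0, hE⟩ : ∃ E' : ℝ, 0 ≤ E' ∧ ∀ k l, Be k l ≤ E' :=
    ⟨max E 0, le_max_right _ _, fun k l => (hBe' k l).trans (le_max_left _ _)⟩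
  obtain ⟨G, hG0, hG⟩ : ∃ G' : ℝ, 0 ≤ G' ∧ ∀ k l, LG k l ≤ G' :=
    ⟨max G 0, le_max_right _ _, fun k l => (hLG' k l).trans (le_max_left _ _)⟩
  obtain ⟨δ, hδ, hδa, hδ1, hδ2, hδ3, hδ4⟩ : ∃ δ : ℝ, 0 < δ ∧ δ ≤ a ∧ 8 * CT * BN ^ 2 * δ ≤ 1 ∧
      8 * LN * δ ≤ 1 ∧ 64 * BN * (CT * BN) * δ ≤ 1 ∧ E * δ ≤ κ := by
    have hEκ : 0 ≤ E / κ := by positivity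
    have hQ : 0 < 1 + 8 * CT * BN ^ 2 + 8 * LN + 64 * BN * (CT * BN) + E / κ := by positivity
    have p1 : 0 ≤ 8 * CT * BN ^ 2 := by positivity
    have p3 : 0 ≤ 64 * BN * (CT * BN) := by positivity
    have key : ∀ t, t ≤ 1 + 8 * CT * BN ^ 2 + 8 * LN + 64 * BN * (CT * BN) + E / κ → 0 ≤ t →
        t * min a (1 / (1 + 8 * CT * BN ^ 2 + 8 * LN + 64 * BN * (CT * BN) + E / κ)) ≤ 1 := by
      intro t ht ht0
      refine (mul_le_mul ht (min_le_right _ _) (by positivity) hQ.le).trans_eq ?_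
      field_simp
    refine ⟨_, lt_min ha (one_div_pos.2 hQ), min_le_left _ _, key _ (by linarith) p1,
      key _ (by linarith) (by positivity), key _ (by linarith) p3, ?_⟩
    have := key (E / κ) (by linarith) hEκ
    rwa [div_mul_eq_mul_div, div_le_one hκ] at this
  have hval : ∀ x ∈ Ω, |ζ x| ≤ δ → -ζ x / 2 ≤ ζ (reflE ζ N x) := by
    intro x hx hxδ
    have hneg : ζ x < 0 := by rw [hΩ] at hx; exact hx
    obtain ⟨hg, hNx⟩ := hlayer x (subset_closure hx) (hxδ.trans hδa)
    have hg' : ‖gradE ζ x‖ ≠ 0 := norm_ne_zero_iff.2 hg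
    have ht := hCT x (hmemΩ x hx) _ (hmemR x hx)
    have e1 : reflE ζ N x - x = -((2 * ζ x) • N x) := by rw [reflE]; abel
    have e2 : fderiv ℝ ζ x (N x) = 1 := by
      rw [← inner_gradE, hNx, real_inner_smul_right, real_inner_self_eq_norm_sq]
      field_simp
    rw [e1, map_neg, map_smul, e2, norm_neg, norm_smul, mul_pow, Real.norm_eq_abs, Real.norm_eq_abs,
      sq_abs, smul_eq_mul, mul_one] at ht
    have h1 := (abs_le.1 ht).1
    have h2 : ‖N x‖ ^ 2 ≤ BN ^ 2 := pow_le_pow_left₀ (norm_nonneg _) (hBN x hx) 2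
    rw [abs_of_neg hneg] at hxδ
    have h3 : CT * ((2 * ζ x) ^ 2 * ‖N x‖ ^ 2) ≤ -ζ x / 2 :=
      calc CT * ((2 * ζ x) ^ 2 * ‖N x‖ ^ 2) ≤ CT * ((2 * ζ x) ^ 2 * BN ^ 2) := by gcongr
        _ = (4 * CT * BN ^ 2 * -ζ x) * (-ζ x) := by ring
        _ ≤ (1 / 2) * (-ζ x) := by
          refine mul_le_mul_of_nonneg_right ?_ (by linarith)
          have : 4 * CT * BN ^ 2 * -ζ x ≤ 4 * CT * BN ^ 2 * δ := by gcongr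
          linarith
        _ = _ := by ring
    linarith
  have hanti : ∀ x ∈ Ω, |ζ x| ≤ δ → ∀ y ∈ Ω, |ζ y| ≤ δ →
      ‖x - y‖ ≤ 2 * ‖reflE ζ N x - reflE ζ N y‖ := by
    intro x hx hxδ y hy hyδ
    obtain ⟨hg, hNx⟩ := hlayer x (subset_closure hx) (hxδ.trans hδa)
    by_cases hnear : 8 * (CT * BN) * ‖x - y‖ ≤ 1
    · have e1 : reflE ζ N x - reflE ζ N y =
          ((x - y) - (2 * ⟪gradE ζ x, x - y⟫) • (‖gradE ζ x‖ ^ 2)⁻¹ • gradE ζ x) +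
          ((2 * (ζ y - ζ x - fderiv ℝ ζ x (y - x))) • N x + (-(2 * ζ y)) • (N x - N y)) := by
        rw [← hNx, inner_gradE, ← neg_sub x y, map_neg, reflE, reflE]
        module
      have h1 : ‖(2 * (ζ y - ζ x - fderiv ℝ ζ x (y - x))) • N x‖ ≤ ‖x - y‖ / 4 := by
        have ht := hCT x (hmemΩ x hx) y (hmemΩ y hy)
        rw [norm_sub_rev y x] at ht
        rw [norm_smul, norm_mul, Real.norm_ofNat]
        calc 2 * ‖ζ y - ζ x - fderiv ℝ ζ x (y - x)‖ * ‖N x‖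
            ≤ 2 * (CT * ‖x - y‖ ^ 2) * BN := by
              have := hBN x hx
              gcongr
          _ = (8 * (CT * BN) * ‖x - y‖) * (‖x - y‖ / 4) := by ring
          _ ≤ 1 * (‖x - y‖ / 4) := by gcongr
          _ = _ := one_mul _
      have h2 : ‖(-(2 * ζ y)) • (N x - N y)‖ ≤ ‖x - y‖ / 4 := by
        have ht := hLN x (hmemΩ x hx) y (hmemΩ y hy)
        rw [norm_smul, norm_neg, norm_mul, Real.norm_ofNat, Real.norm_eq_abs]
        calc 2 * |ζ y| * ‖N x - N y‖ ≤ 2 * δ * (LN * ‖x - y‖) := by gcongr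
          _ = (8 * LN * δ) * (‖x - y‖ / 4) := by ring
          _ ≤ 1 * (‖x - y‖ / 4) := by gcongr
          _ = _ := one_mul _
      have h3 := norm_sub_two_inner_smul hg (x - y)
      have h4 := (norm_add_le _ _).trans (add_le_add h1 h2)
      rw [e1]
      have h5 := norm_sub_le_norm_add
        ((x - y) - (2 * ⟪gradE ζ x, x - y⟫) • (‖gradE ζ x‖ ^ 2)⁻¹ • gradE ζ x)
        ((2 * (ζ y - ζ x - fderiv ℝ ζ x (y - x))) • N x + (-(2 * ζ y)) • (N x - N y))
      rw [h3] at h5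
      linarith
    · have e1 : reflE ζ N x - reflE ζ N y =
          (x - y) + ((-(2 * ζ x)) • N x + (2 * ζ y) • N y) := by
        rw [reflE, reflE]; module
      have h1 : ‖(-(2 * ζ x)) • N x‖ ≤ 2 * δ * BN := by
        rw [norm_smul, norm_neg, norm_mul, Real.norm_ofNat, Real.norm_eq_abs]
        have := hBN x hx
        gcongr
      have h2 : ‖(2 * ζ y) • N y‖ ≤ 2 * δ * BN := by
        rw [norm_smul, norm_mul, Real.norm_ofNat, Real.norm_eq_abs]
        have := hBN y hy
        gcongr
      have h4 := (norm_add_le _ _).trans (add_le_add h1 h2)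
      have h5 := norm_sub_le_norm_add (x - y) ((-(2 * ζ x)) • N x + (2 * ζ y) • N y)
      have h6 : 8 * δ * BN ≤ ‖x - y‖ := by
        by_contra hlt
        refine hnear ?_
        calc 8 * (CT * BN) * ‖x - y‖ ≤ 8 * (CT * BN) * (8 * δ * BN) := by
              have := (not_le.1 hlt).le
              gcongr
          _ = 64 * BN * (CT * BN) * δ := by ring
          _ ≤ 1 := hδ3
      rw [e1]
      linarith
  have hsmall : ∀ k l, ∀ x ∈ Ω, |ζ x| ≤ δ →
      |pushMetric (reflE ζ N) k l x - (if k = l then 1 else 0)| ≤ E * |ζ x| := by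
    intro k l x hx hxδ
    obtain ⟨hg, hNx⟩ := hlayer x (subset_closure hx) (hxδ.trans hδa)
    rw [he k l x hg hNx, abs_mul, mul_comm]
    exact mul_le_mul_of_nonneg_right ((hBe k l x hx).trans (hE k l)) (abs_nonneg _)
  refine ⟨δ, 2 * E * Lζ + 2 * G, hδ, hδa, by positivity, ?_, hanti, ?_, ?_, ?_⟩
  · intro x hx hxδ hmem
    have h1 := hval x hx hxδ
    rw [hΩ] at hx hmem
    have h2 : ζ x < 0 := hx
    have h3 : ζ (reflE ζ N x) < 0 := hmem
    linarith
  · intro k l x hx hxδ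
    exact (hsmall k l x hx hxδ).trans ((mul_le_mul_of_nonneg_left hxδ hE0).trans hδ4)
  · intro k l x hx hxδ y hy
    have h1 := hval x hx hxδ
    have h2 := hLζ _ (hmemR x hx) y (hmemΩ y hy)
    have hx0 : ζ x < 0 := by rw [hΩ] at hx; exact hx
    have hy0 : ζ y < 0 := by rw [hΩ] at hy; exact hy
    have h3 : |ζ x| ≤ 2 * (Lζ * ‖reflE ζ N x - y‖) := by
      rw [abs_of_neg hx0]
      have := le_abs_self (ζ (reflE ζ N x) - ζ y)
      rw [Real.norm_eq_abs] at h2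
      linarith
    calc _ ≤ E * |ζ x| := hsmall k l x hx hxδ
      _ ≤ E * (2 * (Lζ * ‖reflE ζ N x - y‖)) := by gcongr
      _ ≤ E * (2 * (Lζ * ‖reflE ζ N x - y‖)) + 2 * G * ‖reflE ζ N x - y‖ :=
        le_add_of_nonneg_right (by positivity)
      _ = _ := by ring
  · intro k l x hx hxδ y hy hyδ
    calc _ ≤ LG k l * ‖x - y‖ := hLG k l x (hmemΩ x hx) y (hmemΩ y hy)
      _ ≤ G * (2 * ‖reflE ζ N x - reflE ζ N y‖) := by
        have := hanti x hx hxδ y hy hyδ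
        have := hG k l
        gcongr
      _ ≤ G * (2 * ‖reflE ζ N x - reflE ζ N y‖) + 2 * E * Lζ * ‖reflE ζ N x - reflE ζ N y‖ :=
        le_add_of_nonneg_right (by positivity)
      _ = _ := by ring

end Layer

section Coefficients

variable {d : ℕ} {ζ : Eu d → ℝ} {Ω : Set (Eu d)}

theorem half_sum_sq_le_of_abs_sub_le {κ : ℝ} (hκd : κ * d ≤ 1 / 2) {a : Fin d → Fin d → ℝ}
    (ha : ∀ k l, |a k l - (if k = l then 1 else 0)| ≤ κ) (ξ : Fin d → ℝ) :
    (1 / 2) * ∑ k, ξ k ^ 2 ≤ ∑ k, ξ k * ∑ l, a k l * ξ l := by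
  have h1 : ∀ k l, (if k = l then ξ k * ξ l else 0) - κ * ((ξ k ^ 2 + ξ l ^ 2) / 2) ≤
      ξ k * (a k l * ξ l) := by
    intro k l
    have h2 : |(a k l - (if k = l then 1 else 0)) * (ξ k * ξ l)| ≤
        κ * ((ξ k ^ 2 + ξ l ^ 2) / 2) := by
      rw [abs_mul]
      refine mul_le_mul (ha k l) ?_ (abs_nonneg _) ((abs_nonneg _).trans (ha k l))
      rw [abs_le]
      constructor <;> nlinarith [sq_nonneg (ξ k + ξ l), sq_nonneg (ξ k - ξ l)]
    have h3 := (abs_le.1 h2).1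
    split_ifs at h3 ⊢ <;> linarith
  have h2 := Finset.sum_le_sum fun k (_ : k ∈ Finset.univ) =>
    Finset.sum_le_sum fun l (_ : l ∈ Finset.univ) => h1 k l
  simp_rw [← Finset.mul_sum] at h2
  refine le_trans ?_ h2
  simp only [Finset.sum_sub_distrib, ← Finset.mul_sum, ← Finset.sum_div, Finset.sum_add_distrib,
    Finset.sum_ite_eq, Finset.mem_univ, if_true, Finset.sum_const, Finset.card_univ,
    Fintype.card_fin, nsmul_eq_mul, ← sq]
  have h3 : 0 ≤ ∑ k, ξ k ^ 2 := Finset.sum_nonneg fun k _ => sq_nonneg _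
  nlinarith [mul_le_mul_of_nonneg_right hκd h3]

theorem exists_clamped_extension {ι E : Type*} [NormedAddCommGroup E] {p : ι → E} {F : ι → ℝ}
    {L κ : ℝ} (hL : 0 ≤ L) (h : ∀ a b, |F a - F b| ≤ L * ‖p a - p b‖)
    (hF : ∀ a, |F a| ≤ κ) (hκ : 0 ≤ κ) :
    ∃ G : E → ℝ, (∀ x y, |G x - G y| ≤ L * ‖x - y‖) ∧ (∀ a, G (p a) = F a) ∧ ∀ x, |G x| ≤ κ := by
  obtain ⟨G, hG, hGF⟩ := exists_lipschitz_factorization hL h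
  refine ⟨fun x => max (-κ) (min κ (G x)), fun x y => ?_, fun a => ?_, fun x => ?_⟩
  · refine (abs_max_sub_max_le_max _ _ _ _).trans (max_le ?_ ?_)
    · simp only [sub_self, abs_zero]
      positivity
    · refine (abs_min_sub_min_le_max _ _ _ _).trans (max_le ?_ (hG x y))
      simp only [sub_self, abs_zero]
      positivity
  · obtain ⟨h1, h2⟩ := abs_le.1 (hF a)
    simp only [hGF]
    rw [min_eq_right h2, max_eq_right h1]
  · exact abs_le.2 ⟨le_max_left _ _, max_le (by linarith) (min_le_left _ _)⟩

theorem exists_coefficients {N : Eu d → Eu d} {δ κ L : ℝ} (hκ : 0 ≤ κ) (hL : 0 ≤ L)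
    (H : ReflectionLayer ζ N Ω δ κ L) (k l : Fin d) :
    ∃ a : Eu d → ℝ, (∀ x y, |a x - a y| ≤ L * ‖x - y‖) ∧
      (∀ x ∈ Ω, a x = if k = l then 1 else 0) ∧
      (∀ x ∈ Ω, |ζ x| ≤ δ → a (reflE ζ N x) = pushMetric (reflE ζ N) k l x) ∧
      ∀ x, |a x - (if k = l then 1 else 0)| ≤ κ := by
  obtain ⟨G, hG, hGF, hGκ⟩ := exists_clamped_extension (ι := Ω ⊕ {x // x ∈ Ω ∧ |ζ x| ≤ δ})
    (p := Sum.elim (fun x => x.1) fun x => reflE ζ N x.1)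
    (F := Sum.elim (fun _ => 0) fun x =>
      pushMetric (reflE ζ N) k l x.1 - (if k = l then 1 else 0)) (L := L) (κ := κ) hL (by
      rintro (⟨x, hx⟩ | ⟨x, hx, hxδ⟩) (⟨y, hy⟩ | ⟨y, hy, hyδ⟩)
      · simp only [Sum.elim_inl, sub_self, abs_zero]
        positivity
      · simp only [Sum.elim_inl, Sum.elim_inr]
        rw [zero_sub, abs_neg, norm_sub_rev]
        exact H.dist k l y hy hyδ x hx
      · simp only [Sum.elim_inl, Sum.elim_inr]
        rw [sub_zero]
        exact H.dist k l x hx hxδ y hy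
      · simp only [Sum.elim_inr, sub_sub_sub_cancel_right]
        exact H.lipschitz k l x hx hxδ y hy hyδ) (by
      rintro (⟨x, hx⟩ | ⟨x, hx, hxδ⟩)
      · simpa using hκ
      · exact H.small k l x hx hxδ) hκ
  refine ⟨fun x => (if k = l then 1 else 0) + G x, fun x y => ?_, fun x hx => ?_,
    fun x hx hxδ => ?_, fun x => ?_⟩
  · rw [add_sub_add_left_eq_sub]
    exact hG x y
  · have : G x = 0 := hGF (Sum.inl ⟨x, hx⟩)
    simp only [this, add_zero]
  · have : G (reflE ζ N x) = pushMetric (reflE ζ N) k l x - (if k = l then 1 else 0) :=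
      hGF (Sum.inr ⟨x, hx, hxδ⟩)
    simp only [this, add_sub_cancel]
  · rw [add_sub_cancel_left]
    exact hGκ x

theorem pushMetric_id (k l : Fin d) (x : Eu d) :
    pushMetric (fun x => x) k l x = if k = l then 1 else 0 := by
  have h : ∀ i k, partialE i (fun y : Eu d => y k) x = if i = k then 1 else 0 := by
    intro i k
    have h1 : fderiv ℝ (fun y : Eu d => y k) x = (EuclideanSpace.proj k : Eu d →L[ℝ] ℝ) :=
      (EuclideanSpace.proj k : Eu d →L[ℝ] ℝ).hasFDerivAt.fderiv
    rw [partialE, h1]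
    simp [basisE, eq_comm]
  simp [pushMetric, h, eq_comm]

theorem exists_energyKernels (hζ : ContDiff ℝ (⊤ : ℕ∞) ζ) (hΩ : Ω = {x | ζ x < 0})
    (hb : IsBounded Ω) (hgrad : ∀ x ∈ frontier Ω, gradient ζ x ≠ 0) :
    ∃ C : ℝ, 0 ≤ C ∧ ∀ ε : ℝ, 0 < ε → ε ≤ 1 →
      ∃ r h P f A, EnergyKernel ζ Ω C ε r h P f A := by
  have hm : MeasurableSet Ω := hΩ ▸ (isOpen_lt hζ.continuous continuous_const).measurableSet
  obtain ⟨a, ha, hlay⟩ := exists_layer hζ hΩ hb hgrad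
  obtain ⟨N, hN, hNeq⟩ := exists_normal_field hζ ha
  have hg : ∀ x, a ≤ ‖gradE ζ x‖ ^ 2 → gradE ζ x ≠ 0 := fun x hx h0 => by
    rw [h0, norm_zero] at hx
    norm_num at hx
    linarith
  have hκ : (0 : ℝ) < 1 / (2 * (d + 1)) := by positivity
  have hκd : 1 / (2 * ((d : ℝ) + 1)) * d ≤ 1 / 2 := by
    rw [div_mul_eq_mul_div, div_le_div_iff₀ (by positivity) (by norm_num)]
    linarith
  obtain ⟨δ, L, hδ, hδa, hL, H⟩ := exists_reflectionLayer hζ hΩ hb hN ha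
    (fun x hx hxa => ⟨hg x (hlay x hx hxa), hNeq x (hlay x hx hxa)⟩) hκ
  choose A hAlip hAin hAout hAκ using exists_coefficients hκ.le hL H
  let θ : ContDiffBump (0 : ℝ) := ⟨δ / 2, δ, by positivity, by linarith⟩
  have hχ : ContDiff ℝ (⊤ : ℕ∞) fun x => θ (ζ x) := θ.contDiff.comp hζ
  have hsupp : ∀ x ∈ tsupport fun x => θ (ζ x), |ζ x| ≤ δ := by
    intro x hx
    have h1 : tsupport (fun x => θ (ζ x)) ⊆ {x | |ζ x| ≤ δ} :=
      closure_minimal (fun y hy => by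
        have : ζ y ∈ Function.support θ := hy
        rw [θ.support_eq] at this
        simpa using (mem_ball_zero_iff.1 this).le) (isClosed_le hζ.continuous.abs continuous_const)
    exact h1 hx
  have hfr : ∀ x ∈ frontier Ω, ζ x = 0 := fun x => eq_zero_of_mem_frontier hζ.continuous hΩ
  have hev : ∀ x ∈ frontier Ω, (fun x => θ (ζ x)) =ᶠ[𝓝 x] fun _ => 1 := fun x hx =>
    hζ.continuous.continuousAt.eventually (p := fun s => θ s = 1) (by
      rw [hfr x hx]; exact θ.eventuallyEq_one)
  refine exists_energyKernel (c := 2) (L := L) (R := reflE ζ N) (χ := fun x => θ (ζ x)) hm hb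
    (by norm_num) hL (fun k l => ?_)
    (fun z ξ => half_sum_sq_le_of_abs_sub_le hκd (fun k l => hAκ k l z) ξ)
    ⟨contDiff_id, contDiff_const, fun x _ y _ => ?_, fun x hx k l z => ?_⟩
    ⟨contDiff_reflE hζ hN, hχ, fun x hx y hy => H.antilipschitz x hx.1 (hsupp x hx.2) y hy.1
      (hsupp y hy.2), fun x hx k l z => ?_⟩
    (fun x hx => by simp [reflE, hfr x hx]) (fun x hx => (hev x hx).self_of_nhds)
    (fun x hx => by rw [(hev x hx).fderiv_eq]; simp) (fun x hx => ?_)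
    (fun x hx h0 => H.outside x hx (hsupp x (subset_tsupport _ h0)))
  · refine (LipschitzWith.of_dist_le_mul (K := L.toNNReal) fun x y => ?_).continuous
    rw [Real.coe_toNNReal L hL, dist_eq_norm, dist_eq_norm]
    exact hAlip k l x y
  · linarith [norm_nonneg (x - y)]
  · rw [pushMetric_id, ← hAin k l x hx.1, norm_sub_rev]
    exact hAlip k l z x
  · rw [← hAout k l x hx.1 (hsupp x hx.2), norm_sub_rev]
    exact hAlip k l z _
  · have h1 := hlay x (frontier_subset_closure hx) (by rw [hfr x hx, abs_zero]; exact ha.le)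
    exact fderiv_reflE_unitNormal hζ hN (hfr x hx) (hg x h1) (hNeq x h1)

end Coefficients

/-- if `ρ ∈ L²((0,T)×Ω)` satisfies the weak formulation of the Neumann
heat equation with initial datum `ρ_in ∈ L²(Ω)`, then each distributional spatial
derivative `∂ρ/∂x_i` is represented by a function `g_i ∈ L²((0,T)×Ω)` whose `L²` norm is
bounded by a constant depending only on the `L²` norms of `ρ_in` and `ρ`
(i.e. `ρ ∈ L²(0,T; H¹(Ω))`). -/
theorem statement19 (d : ℕ) (hd : 1 ≤ d) (T : ℝ) (hT : 0 < T)
    (ζ : Eu d → ℝ) (hζ : ContDiff ℝ (⊤ : ℕ∞) ζ)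
    (Ω : Set (Eu d)) (hΩ : Ω = {x | ζ x < 0}) (hΩbdd : IsBounded Ω)
    (hgrad : ∀ x ∈ frontier Ω, gradient ζ x ≠ 0) :
    ∃ C : ℝ → ℝ → ℝ,
      ∀ (ρ : ℝ → Eu d → ℝ) (ρin : Eu d → ℝ),
        Measurable (fun p : ℝ × Eu d => ρ p.1 p.2) →
        IntegrableOn (fun p : ℝ × Eu d => (ρ p.1 p.2) ^ 2) (Ioo 0 T ×ˢ Ω) →
        Measurable ρin →
        IntegrableOn (fun x => (ρin x) ^ 2) Ω →
        -- weak formulation of the Neumann heat equation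
        (∀ ψ : ℝ → Eu d → ℝ,
          ContDiff ℝ (⊤ : ℕ∞) (fun p : ℝ × Eu d => ψ p.1 p.2) →
          (∀ x, ψ T x = 0) →
          (∀ t ∈ Ioo (0 : ℝ) T, ∀ x ∈ frontier Ω,
            fderiv ℝ (fun y => ψ t y) x (unitNormal ζ x) = 0) →
          (∫ t in Ioo (0 : ℝ) T, ∫ x in Ω,
              ρ t x * (deriv (fun s => ψ s x) t + lapE (fun y => ψ t y) x))
            + (∫ x in Ω, ρin x * ψ 0 x) = 0) →
        ∀ i : Fin d, ∃ g : ℝ → Eu d → ℝ,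
          Measurable (fun p : ℝ × Eu d => g p.1 p.2) ∧
          IntegrableOn (fun p : ℝ × Eu d => (g p.1 p.2) ^ 2) (Ioo 0 T ×ˢ Ω) ∧
          -- g represents the distributional derivative ∂ρ/∂x_i
          (∀ u : ℝ → Eu d → ℝ,
            ContDiff ℝ (⊤ : ℕ∞) (fun p : ℝ × Eu d => u p.1 p.2) →
            HasCompactSupport (fun p : ℝ × Eu d => u p.1 p.2) →
            tsupport (fun p : ℝ × Eu d => u p.1 p.2) ⊆ Ioo 0 T ×ˢ Ω →
            (∫ t in Ioo (0 : ℝ) T, ∫ x in Ω, ρ t x * fderiv ℝ (fun y => u t y) x (basisE d i))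
              = -∫ t in Ioo (0 : ℝ) T, ∫ x in Ω, g t x * u t x) ∧
          -- L² bound depending only on the L² norms of ρin and ρ
          (∫ t in Ioo (0 : ℝ) T, ∫ x in Ω, (g t x) ^ 2)
            ≤ C (∫ x in Ω, (ρin x) ^ 2) (∫ t in Ioo (0 : ℝ) T, ∫ x in Ω, (ρ t x) ^ 2) := by
  have hm : MeasurableSet Ω := hΩ ▸ (isOpen_lt hζ.continuous continuous_const).measurableSet
  exact exists_weak_gradient_of_energyKernels d T hT ζ Ω hm hΩbdd
    (exists_energyKernels hζ hΩ hΩbdd hgrad)
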